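/- arXiv:0812.2216 — 11 statements merged into one kernel-verified Lean document; each statement's English description precedes it below -/
import Mathlib

section
/- Let X be a normed space over ℝ and let Y be its completion (with X isometrically embedded as a dense subspace of Y). Then for every p ∈ [1,∞], X is of Banach-Mazur type p if and only if Y is of Banach-Mazur type p; and X is of unconditional Banach-Mazur type p if and only if Y is of unconditional Banach-Mazur type p. -/
open Filter Topology ENNReal

/-- A sequence in a normed space over `ℝ` converges weakly to zero if every continuous linear
functional sends it to a real sequence converging to `0`. -/
def WeaklyNull {X : Type*} [NormedAddCommGroup X] [NormedSpace ℝ X] (x : ℕ → X) : Prop :=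
  ∀ f : X →L[ℝ] ℝ, Tendsto (fun n => f (x n)) atTop (𝓝 0)

/-- `X` is of Banach-Mazur type `p ∈ [1,∞]` (with the convention `N ^ (1/∞) = N ^ 0 = 1`):
every weakly null sequence has a subsequence whose partial sums of the first `N` terms are
bounded by `C * N ^ (1/p)` for some constant `C > 0`. -/
def BMType (X : Type*) [NormedAddCommGroup X] [NormedSpace ℝ X] (p : ℝ≥0∞) : Prop :=
  ∀ x : ℕ → X, WeaklyNull x →
    ∃ n : ℕ → ℕ, StrictMono n ∧ ∃ C : ℝ, 0 < C ∧
      ∀ N : ℕ, ‖∑ k ∈ Finset.range N, x (n k)‖ ≤ C * (N : ℝ) ^ (1 / p).toReal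

/-- `X` is of unconditional Banach-Mazur type `p ∈ [1,∞]`: every weakly null sequence has a
subsequence such that every further subsequence has partial sums bounded by `C * N ^ (1/p)`
for some constant `C > 0` (depending on the further subsequence). -/
def BMUncondType (X : Type*) [NormedAddCommGroup X] [NormedSpace ℝ X] (p : ℝ≥0∞) : Prop :=
  ∀ x : ℕ → X, WeaklyNull x →
    ∃ n : ℕ → ℕ, StrictMono n ∧
      ∀ m : ℕ → ℕ, StrictMono m → ∃ C : ℝ, 0 < C ∧
        ∀ N : ℕ, ‖∑ k ∈ Finset.range N, x (n (m k))‖ ≤ C * (N : ℝ) ^ (1 / p).toReal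

theorem bm_weaklyNull_map {X Y : Type*} [NormedAddCommGroup X] [NormedSpace ℝ X]
    [NormedAddCommGroup Y] [NormedSpace ℝ Y] (e : X →ₗᵢ[ℝ] Y) (x : ℕ → X)
    (hx : WeaklyNull x) : WeaklyNull (fun n => e (x n)) := by
  intro f
  exact hx (f.comp e.toContinuousLinearMap)

theorem bm_norm_sum {X Y : Type*} [NormedAddCommGroup X] [NormedSpace ℝ X]
    [NormedAddCommGroup Y] [NormedSpace ℝ Y] (e : X →ₗᵢ[ℝ] Y) (x : ℕ → X) (N : ℕ) :
    ‖∑ k ∈ Finset.range N, e (x k)‖ = ‖∑ k ∈ Finset.range N, x k‖ := by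
  rw [← map_sum, e.norm_map]

theorem bm_approx {X Y : Type*} [NormedAddCommGroup X] [NormedSpace ℝ X]
    [NormedAddCommGroup Y] [NormedSpace ℝ Y]
    (e : X →ₗᵢ[ℝ] Y) (he : DenseRange e) (y : ℕ → Y) (hy : WeaklyNull y) :
    ∃ x : ℕ → X, WeaklyNull x ∧ ∀ n, ‖y n - e (x n)‖ ≤ (1 / 2 : ℝ) ^ n := by
  have h : ∀ n, ∃ x : X, ‖y n - e x‖ ≤ (1 / 2 : ℝ) ^ n := by
    intro n
    obtain ⟨x, hx⟩ := he.exists_dist_lt (y n) (show (0 : ℝ) < (1 / 2) ^ n by positivity)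
    exact ⟨x, by rw [← dist_eq_norm]; exact hx.le⟩
  choose x hx using h
  refine ⟨x, ?_, hx⟩
  intro f
  have hui : IsUniformInducing e.toContinuousLinearMap := e.isometry.isUniformInducing
  set g : Y →L[ℝ] ℝ := f.extend e.toContinuousLinearMap with hg
  have hge : ∀ z, g (e z) = f z := fun z =>
    ContinuousLinearMap.extend_eq (e := e.toContinuousLinearMap) f he hui z
  have hd : Tendsto (fun n => y n - e (x n)) atTop (𝓝 0) := by
    refine squeeze_zero_norm hx ?_
    exact tendsto_pow_atTop_nhds_zero_of_lt_one (by norm_num) (by norm_num)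
  have h1 := (hy g).sub ((g.continuous.tendsto 0).comp hd)
  simpa [hge, Function.comp_def] using h1

theorem bm_transfer {X Y : Type*} [NormedAddCommGroup X] [NormedSpace ℝ X]
    [NormedAddCommGroup Y] [NormedSpace ℝ Y] (e : X →ₗᵢ[ℝ] Y) (x : ℕ → X) (y : ℕ → Y)
    (h : ∀ n, ‖y n - e (x n)‖ ≤ (1 / 2 : ℝ) ^ n) (n : ℕ → ℕ) (hn : StrictMono n)
    (s : ℝ) (hs : 0 ≤ s)
    (hC : ∃ C : ℝ, 0 < C ∧ ∀ N : ℕ, ‖∑ k ∈ Finset.range N, x (n k)‖ ≤ C * (N : ℝ) ^ s) :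
    ∃ C : ℝ, 0 < C ∧ ∀ N : ℕ, ‖∑ k ∈ Finset.range N, y (n k)‖ ≤ C * (N : ℝ) ^ s := by
  obtain ⟨C, hC0, hC⟩ := hC
  refine ⟨C + 2, by linarith, fun N => ?_⟩
  rcases Nat.eq_zero_or_pos N with rfl | hN
  · simp only [Finset.range_zero, Finset.sum_empty, norm_zero]
    positivity
  have h1 : (1 : ℝ) ≤ (N : ℝ) ^ s := Real.one_le_rpow (by exact_mod_cast hN) hs
  have h2 : ‖∑ k ∈ Finset.range N, (y (n k) - e (x (n k)))‖ ≤ 2 := by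
    refine (norm_sum_le_of_le _ (fun k _ => (h (n k)).trans ?_)).trans (sum_geometric_two_le N)
    exact pow_le_pow_of_le_one (by norm_num) (by norm_num) (hn.id_le k)
  have h3 : ∑ k ∈ Finset.range N, y (n k)
      = ∑ k ∈ Finset.range N, (y (n k) - e (x (n k))) + ∑ k ∈ Finset.range N, e (x (n k)) := by
    rw [← Finset.sum_add_distrib]; simp
  have h4 := bm_norm_sum e (fun k => x (n k)) N
  have h5 := hC N
  rw [h3]
  refine (norm_add_le _ _).trans ?_
  rw [h4]
  nlinarith

/-- Let `Y` be the completion of the normed space `X`, i.e. `Y` is a complete normed space and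
`X` embeds isometrically onto a dense subspace of `Y`. Then for every `p ∈ [1,∞]`, `X` is of
(unconditional) Banach-Mazur type `p` if and only if `Y` is. -/
theorem bmType_completion (X Y : Type*) [NormedAddCommGroup X] [NormedSpace ℝ X]
    [NormedAddCommGroup Y] [NormedSpace ℝ Y] [CompleteSpace Y]
    (e : X →ₗᵢ[ℝ] Y) (he : DenseRange e) (p : ℝ≥0∞) (hp : 1 ≤ p) :
    (BMType X p ↔ BMType Y p) ∧ (BMUncondType X p ↔ BMUncondType Y p) := by
  have hs : 0 ≤ (1 / p).toReal := ENNReal.toReal_nonneg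
  refine ⟨⟨fun hX y hy => ?_, fun hY x hx => ?_⟩, ⟨fun hX y hy => ?_, fun hY x hx => ?_⟩⟩
  · obtain ⟨x, hx, hxy⟩ := bm_approx e he y hy
    obtain ⟨n, hn, hC⟩ := hX x hx
    exact ⟨n, hn, bm_transfer e x y hxy n hn _ hs hC⟩
  · obtain ⟨n, hn, C, hC0, hC⟩ := hY _ (bm_weaklyNull_map e x hx)
    refine ⟨n, hn, C, hC0, fun N => ?_⟩
    rw [← bm_norm_sum e (fun k => x (n k))]
    exact hC N
  · obtain ⟨x, hx, hxy⟩ := bm_approx e he y hy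
    obtain ⟨n, hn, hC⟩ := hX x hx
    exact ⟨n, hn, fun m hm =>
      bm_transfer e x y hxy (fun k => n (m k)) (hn.comp hm) _ hs (hC m hm)⟩
  · obtain ⟨n, hn, hC⟩ := hY _ (bm_weaklyNull_map e x hx)
    refine ⟨n, hn, fun m hm => ?_⟩
    obtain ⟨C, hC0, hC⟩ := hC m hm
    refine ⟨C, hC0, fun N => ?_⟩
    rw [← bm_norm_sum e (fun k => x (n (m k)))]
    exact hC N
end

section
/- Let X be a normed space over ℝ and p ∈ [1,∞]. Then X is of Banach-Mazur type p if and only if every closed separable linear subspace of X (with the induced norm) is of Banach-Mazur type p. The analogous equivalence holds for the unconditional Banach-Mazur type. -/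
open Filter Topology ENNReal

/-- A sequence in a subspace is weakly null there iff it is weakly null in the whole space. -/
lemma weaklyNull_coe_iff {X : Type*} [NormedAddCommGroup X] [NormedSpace ℝ X]
    (U : Submodule ℝ X) (x : ℕ → U) :
    WeaklyNull (fun n => (x n : X)) ↔ WeaklyNull x := by
  constructor
  · intro h f
    obtain ⟨g, hg, -⟩ := exists_extension_norm_eq U f
    simpa [hg] using h g
  · intro h f
    exact h (f.comp U.subtypeL)

/-- Every sequence lies in a closed separable subspace. -/
lemma exists_closed_separable {X : Type*} [NormedAddCommGroup X] [NormedSpace ℝ X]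
    (x : ℕ → X) : ∃ U : Submodule ℝ X, IsClosed (U : Set X) ∧
      TopologicalSpace.SeparableSpace U ∧ ∀ n, x n ∈ U := by
  refine ⟨(Submodule.span ℝ (Set.range x)).topologicalClosure,
    Submodule.isClosed_topologicalClosure _, ?_, fun n =>
      Submodule.le_topologicalClosure _ (Submodule.subset_span ⟨n, rfl⟩)⟩
  have h : TopologicalSpace.IsSeparable
      ((Submodule.span ℝ (Set.range x)).topologicalClosure : Set X) := by
    rw [Submodule.topologicalClosure_coe]
    exact ((Set.countable_range x).isSeparable.span (R := ℝ)).closure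
  exact h.separableSpace

/-- A normed space `X` is of (unconditional) Banach-Mazur type `p ∈ [1,∞]` if and only if
every closed separable linear subspace of `X`, with the induced norm, is of (unconditional)
Banach-Mazur type `p`. -/
theorem bmType_iff_separable_subspaces (X : Type*) [NormedAddCommGroup X] [NormedSpace ℝ X]
    (p : ℝ≥0∞) (hp : 1 ≤ p) :
    (BMType X p ↔ ∀ U : Submodule ℝ X, IsClosed (U : Set X) →
      TopologicalSpace.SeparableSpace U → BMType U p) ∧
    (BMUncondType X p ↔ ∀ U : Submodule ℝ X, IsClosed (U : Set X) →
      TopologicalSpace.SeparableSpace U → BMUncondType U p) := by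
  refine ⟨⟨fun h U _ _ x hx => ?_, fun h x hx => ?_⟩, ⟨fun h U _ _ x hx => ?_, fun h x hx => ?_⟩⟩
  · obtain ⟨n, hn, C, hC, hb⟩ := h _ ((weaklyNull_coe_iff U x).2 hx)
    refine ⟨n, hn, C, hC, fun N => ?_⟩
    have := hb N
    rwa [← Submodule.coe_sum, ← Submodule.coe_norm] at this
  · obtain ⟨U, hU, hs, hm⟩ := exists_closed_separable x
    obtain ⟨n, hn, C, hC, hb⟩ := h U hU hs (fun n => ⟨x n, hm n⟩)
      ((weaklyNull_coe_iff U _).1 hx)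
    refine ⟨n, hn, C, hC, fun N => ?_⟩
    have := hb N
    rwa [Submodule.coe_norm, Submodule.coe_sum] at this
  · obtain ⟨n, hn, hmm⟩ := h _ ((weaklyNull_coe_iff U x).2 hx)
    refine ⟨n, hn, fun m hm => ?_⟩
    obtain ⟨C, hC, hb⟩ := hmm m hm
    refine ⟨C, hC, fun N => ?_⟩
    have := hb N
    rwa [← Submodule.coe_sum, ← Submodule.coe_norm] at this
  · obtain ⟨U, hU, hs, hm⟩ := exists_closed_separable x
    obtain ⟨n, hn, hmm⟩ := h U hU hs (fun n => ⟨x n, hm n⟩)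
      ((weaklyNull_coe_iff U _).1 hx)
    refine ⟨n, hn, fun m hm => ?_⟩
    obtain ⟨C, hC, hb⟩ := hmm m hm
    refine ⟨C, hC, fun N => ?_⟩
    have := hb N
    rwa [Submodule.coe_norm, Submodule.coe_sum] at this
end

section
/- Let X and Y be Banach spaces over ℝ, let X be reflexive (the canonical inclusion of X into its double dual is surjective), and let T : X → Y be a bounded linear operator that is onto. If X is of Banach-Mazur type p ∈ [1,∞], then Y is of Banach-Mazur type p. The analogous statement holds for the unconditional Banach-Mazur type. -/
open Filter Topology ENNReal

theorem aux_ultra {X : Type*} [NormedAddCommGroup X] [NormedSpace ℝ X]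
    (hrefl : Function.Surjective (NormedSpace.inclusionInDoubleDual ℝ X))
    (x : ℕ → X) (C : ℝ) (hC : ∀ n, ‖x n‖ ≤ C) (U : Ultrafilter ℕ) :
    ∃ z : X, ∀ f : X →L[ℝ] ℝ, Tendsto (fun n => f (x n)) U (𝓝 (f z)) := by
  have hK := WeakDual.isCompact_closedBall (𝕜 := ℝ) (E := StrongDual ℝ X) 0 C
  let g : ℕ → WeakDual ℝ (StrongDual ℝ X) := fun n =>
    StrongDual.toWeakDual (NormedSpace.inclusionInDoubleDual ℝ X (x n))
  have hg : ∀ n, g n ∈ WeakDual.toStrongDual ⁻¹'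
      Metric.closedBall (0 : StrongDual ℝ (StrongDual ℝ X)) C := by
    intro n
    refine (mem_closedBall_zero_iff (E := StrongDual ℝ (StrongDual ℝ X))).2 ?_
    exact (NormedSpace.double_dual_bound ℝ X (x n)).trans (hC n)
  obtain ⟨φ, -, hφ⟩ := hK.ultrafilter_le_nhds (U.map g) (by
    rw [le_principal_iff]
    exact Filter.mem_map.2 (Filter.univ_mem' hg))
  obtain ⟨z, hz⟩ := hrefl (WeakDual.toStrongDual φ)
  refine ⟨z, fun f => ?_⟩
  have h1 : Tendsto g U (𝓝 φ) := hφ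
  have h2 := ((WeakDual.eval_continuous f).tendsto φ).comp h1
  have h3 : φ f = f z := by
    have := congrArg (fun ψ : StrongDual ℝ (StrongDual ℝ X) => ψ f) hz
    simpa using this.symm
  rw [← h3]
  exact h2

theorem aux_eberlein {X : Type*} [NormedAddCommGroup X] [NormedSpace ℝ X]
    (hrefl : Function.Surjective (NormedSpace.inclusionInDoubleDual ℝ X))
    (x : ℕ → X) (C : ℝ) (hC : ∀ n, ‖x n‖ ≤ C) :
    ∃ n : ℕ → ℕ, StrictMono n ∧ ∃ z : X, ∀ f : X →L[ℝ] ℝ,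
      Tendsto (fun k => f (x (n k))) atTop (𝓝 (f z)) := by
  let S : Submodule ℝ X := (Submodule.span ℝ (Set.range x)).topologicalClosure
  have hxS : ∀ n, x n ∈ S := fun n =>
    Submodule.le_topologicalClosure _ (Submodule.subset_span ⟨n, rfl⟩)
  have hSc : IsClosed (S : Set X) := Submodule.isClosed_topologicalClosure _
  have hsep : TopologicalSpace.IsSeparable (S : Set X) :=
    ((Set.countable_range x).isSeparable.span (R := ℝ)).closure
  obtain ⟨c, hc, hSc'⟩ := hsep
  have : Countable c := hc
  choose d hd1 hd2 using fun i : c => exists_dual_vector'' ℝ (i : X)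
  have hdsep : ∀ z ∈ S, (∀ i, d i z = 0) → z = 0 := by
    intro z hz h0
    by_contra hne
    have hpos : 0 < ‖z‖ := norm_pos_iff.2 hne
    obtain ⟨w, hw, hzw⟩ := Metric.mem_closure_iff.1 (hSc' hz) (‖z‖ / 4) (by positivity)
    have e1 : d ⟨w, hw⟩ w = ‖w‖ := by simpa using hd2 ⟨w, hw⟩
    have e2 : d ⟨w, hw⟩ (w - z) = ‖w‖ := by rw [map_sub, e1, h0, sub_zero]
    have e3 : ‖d ⟨w, hw⟩ (w - z)‖ ≤ 1 * ‖w - z‖ :=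
      (d ⟨w, hw⟩).le_of_opNorm_le (hd1 _) _
    rw [e2, norm_norm, one_mul, norm_sub_rev] at e3
    rw [dist_eq_norm] at hzw
    have := norm_sub_norm_le z w
    linarith
  have hcomp : IsCompact (Set.univ.pi fun _ : c => Metric.closedBall (0 : ℝ) C) :=
    isCompact_univ_pi fun _ => isCompact_closedBall _ _
  obtain ⟨a, -, n, hn, ha⟩ := hcomp.isSeqCompact (x := fun k i => d i (x k)) (by
    intro k i _
    rw [mem_closedBall_zero_iff]
    have := (d i).le_of_opNorm_le (hd1 i) (x k)
    linarith [hC k])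
  have ha' : ∀ i, Tendsto (fun k => d i (x (n k))) atTop (𝓝 (a i)) := fun i =>
    tendsto_pi_nhds.1 ha i
  choose L hL using fun U : Ultrafilter ℕ =>
    aux_ultra hrefl (fun k => x (n k)) C (fun k => hC _) U
  have hLS : ∀ U, L U ∈ S := by
    intro U
    by_contra hnot
    obtain ⟨f, u, h1, h2⟩ := geometric_hahn_banach_closed_point S.convex hSc hnot
    have := le_of_tendsto (hL U f) (Filter.Eventually.of_forall fun k => (h1 _ (hxS (n k))).le)
    linarith
  have hLa : ∀ U : Ultrafilter ℕ, (U : Filter ℕ) ≤ atTop → ∀ i, d i (L U) = a i :=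
    fun U hU i => tendsto_nhds_unique (hL U (d i)) ((ha' i).mono_left hU)
  let U₀ : Ultrafilter ℕ := Ultrafilter.of atTop
  have hU₀ : (U₀ : Filter ℕ) ≤ atTop := Ultrafilter.of_le _
  refine ⟨n, hn, L U₀, fun f => ?_⟩
  rw [tendsto_iff_ultrafilter]
  intro U hU
  have : L U - L U₀ = 0 := hdsep _ (S.sub_mem (hLS _) (hLS _)) fun i => by
    rw [map_sub, hLa U hU, hLa U₀ hU₀, sub_self]
  rw [← sub_eq_zero.1 this]
  exact hL U f

theorem aux_lift {X Y : Type*} [NormedAddCommGroup X] [NormedSpace ℝ X]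
    [CompleteSpace X] [NormedAddCommGroup Y] [NormedSpace ℝ Y] [CompleteSpace Y]
    (hrefl : Function.Surjective (NormedSpace.inclusionInDoubleDual ℝ X))
    (T : X →L[ℝ] Y) (hT : Function.Surjective T) (y : ℕ → Y) (hy : WeaklyNull y) :
    ∃ n : ℕ → ℕ, StrictMono n ∧ ∃ w : ℕ → X, WeaklyNull w ∧ ∀ k, T (w k) = y (n k) := by
  obtain ⟨B, hB⟩ := banach_steinhaus
    (g := fun n => NormedSpace.inclusionInDoubleDual ℝ Y (y n)) (fun f => by
      obtain ⟨K, hK⟩ := (hy f).norm.bddAbove_range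
      exact ⟨K, fun n => hK ⟨n, rfl⟩⟩)
  have hB' : ∀ n, ‖y n‖ ≤ B := fun n => by
    have := (NormedSpace.inclusionInDoubleDualLi (E := Y) ℝ).norm_map (y n)
    rw [← this]
    exact hB n
  obtain ⟨K, hK, hpre⟩ := T.exists_preimage_norm_le hT
  choose g hg1 hg2 using hpre
  obtain ⟨n, hn, z, hz⟩ := aux_eberlein hrefl (fun k => g (y k)) (K * B) (fun k =>
    (hg2 _).trans (mul_le_mul_of_nonneg_left (hB' k) hK.le))
  have hTz : T z = 0 := by
    rw [SeparatingDual.eq_zero_iff_forall_dual_eq_zero (R := ℝ)]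
    intro f
    have h1 := hz (f.comp T)
    simp only [ContinuousLinearMap.comp_apply, hg1] at h1
    exact tendsto_nhds_unique h1 ((hy f).comp hn.tendsto_atTop)
  refine ⟨n, hn, fun k => g (y (n k)) - z, fun f => ?_, fun k => ?_⟩
  · have := (hz f).sub_const (f z)
    simpa using this
  · rw [map_sub, hg1, hTz, sub_zero]

theorem aux_bound {X Y : Type*} [NormedAddCommGroup X] [NormedSpace ℝ X]
    [NormedAddCommGroup Y] [NormedSpace ℝ Y] (T : X →L[ℝ] Y) (w : ℕ → X) (y : ℕ → Y)
    (h : ∀ k, T (w k) = y k) (r : ℝ)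
    (hb : ∃ C : ℝ, 0 < C ∧ ∀ N : ℕ, ‖∑ k ∈ Finset.range N, w k‖ ≤ C * (N : ℝ) ^ r) :
    ∃ C : ℝ, 0 < C ∧ ∀ N : ℕ, ‖∑ k ∈ Finset.range N, y k‖ ≤ C * (N : ℝ) ^ r := by
  obtain ⟨C, hC, hN⟩ := hb
  refine ⟨(‖T‖ + 1) * C, by positivity, fun N => ?_⟩
  have e : ∑ k ∈ Finset.range N, y k = T (∑ k ∈ Finset.range N, w k) := by
    rw [map_sum]
    exact Finset.sum_congr rfl fun k _ => (h k).symm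
  rw [e, mul_assoc]
  exact (T.le_of_opNorm_le (by linarith : ‖T‖ ≤ ‖T‖ + 1) _).trans
    (mul_le_mul_of_nonneg_left (hN N) (by positivity))

/-- Let `X`, `Y` be Banach spaces, `X` reflexive, and `T : X → Y` a surjective bounded linear
operator. If `X` is of (unconditional) Banach-Mazur type `p ∈ [1,∞]`, then so is `Y`. -/
theorem bmType_of_surjective (X Y : Type*) [NormedAddCommGroup X] [NormedSpace ℝ X]
    [CompleteSpace X] [NormedAddCommGroup Y] [NormedSpace ℝ Y] [CompleteSpace Y]
    (hrefl : Function.Surjective (NormedSpace.inclusionInDoubleDual ℝ X))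
    (T : X →L[ℝ] Y) (hT : Function.Surjective T) (p : ℝ≥0∞) (hp : 1 ≤ p) :
    (BMType X p → BMType Y p) ∧ (BMUncondType X p → BMUncondType Y p) := by
  constructor
  · intro h y hy
    obtain ⟨n, hn, w, hw, hwy⟩ := aux_lift hrefl T hT y hy
    obtain ⟨m, hm, hb⟩ := h w hw
    exact ⟨n ∘ m, hn.comp hm, aux_bound T (fun k => w (m k)) _ (fun k => hwy (m k)) _ hb⟩
  · intro h y hy
    obtain ⟨n, hn, w, hw, hwy⟩ := aux_lift hrefl T hT y hy
    obtain ⟨m, hm, hb⟩ := h w hw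
    exact ⟨n ∘ m, hn.comp hm, fun l hl =>
      aux_bound T (fun k => w (m (l k))) _ (fun k => hwy (m (l k))) _ (hb l hl)⟩
end

section
/- Let X be a reflexive Banach space over ℝ (the canonical inclusion of X into its double dual is surjective), let Z be a closed linear subspace of X, and let Y = X/Z be the quotient Banach space with the quotient norm. If X is of Banach-Mazur type p ∈ [1,∞], then Y is of Banach-Mazur type p; likewise for the unconditional Banach-Mazur type. -/
open Filter Topology ENNReal

set_option maxHeartbeats 1000000 in
open NormedSpace in
/-- In a reflexive space, bounded sequences have weakly convergent subsequences. -/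
theorem exists_weak_subseq {X : Type*} [NormedAddCommGroup X] [NormedSpace ℝ X]
    (hrefl : Function.Surjective (NormedSpace.inclusionInDoubleDual ℝ X))
    (x : ℕ → X) (M : ℝ) (hM : ∀ n, ‖x n‖ ≤ M) :
    ∃ (a : X) (φ : ℕ → ℕ), StrictMono φ ∧
      ∀ f : X →L[ℝ] ℝ, Tendsto (fun n => f (x (φ n))) atTop (𝓝 (f a)) := by
  set W : Submodule ℝ X := (Submodule.span ℝ (Set.range x)).topologicalClosure with hW
  have hWc : IsClosed (W : Set X) := Submodule.isClosed_topologicalClosure _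
  have hxW : ∀ n, x n ∈ W := fun n =>
    Submodule.le_topologicalClosure _ (Submodule.subset_span ⟨n, rfl⟩)
  have hsep : TopologicalSpace.IsSeparable (W : Set X) := by
    have h1 : TopologicalSpace.IsSeparable (Set.range x) := (Set.countable_range x).isSeparable
    have h2 := (h1.span (R := ℝ)).closure
    simpa [hW, Submodule.topologicalClosure_coe] using h2
  obtain ⟨c, hc, hWsub⟩ := hsep
  have : Countable c := hc
  have hdual : ∀ i : c, ∃ f : X →L[ℝ] ℝ, ‖f‖ ≤ 1 ∧ f i = ‖(i : X)‖ := fun i => by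
    simpa using exists_dual_vector'' ℝ (i : X)
  choose f hf1 hf2 using hdual
  -- diagonal subsequence
  have hK : IsCompact (Set.univ.pi fun _ : c => Set.Icc (-M) M) :=
    isCompact_univ_pi fun _ => isCompact_Icc
  obtain ⟨L, -, φ, hφ, hL⟩ := hK.tendsto_subseq (x := fun n i => f i (x n)) (by
    intro n i _
    have h := (f i).le_of_opNorm_le (hf1 i) (x n)
    rw [one_mul, Real.norm_eq_abs] at h
    exact abs_le.mp (h.trans (hM n)))
  have hL' : ∀ i, Tendsto (fun n => f i (x (φ n))) atTop (𝓝 (L i)) := fun i =>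
    (tendsto_pi_nhds.mp hL) i
  let u : ℕ → WeakDual ℝ (StrongDual ℝ X) := fun n =>
    StrongDual.toWeakDual (inclusionInDoubleDual ℝ X (x (φ n)))
  obtain ⟨K, hcomp, hmem⟩ : ∃ K : Set (WeakDual ℝ (StrongDual ℝ X)),
      IsCompact K ∧ ∀ n, u n ∈ K := by
    refine ⟨_, WeakDual.isCompact_closedBall (𝕜 := ℝ) 0 M, fun n => ?_⟩
    rw [Set.mem_preimage, mem_closedBall_zero_iff]
    exact (double_dual_bound ℝ X _).trans (hM _)
  have hclus : ∀ (a : X), MapClusterPt (StrongDual.toWeakDual (inclusionInDoubleDual ℝ X a))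
      atTop u → ∀ g : X →L[ℝ] ℝ, MapClusterPt (g a) atTop (fun n => g (x (φ n))) := by
    intro a ha g
    exact ha.continuousAt_comp (f := fun ψ : WeakDual ℝ (StrongDual ℝ X) => ψ g)
      (WeakDual.eval_continuous g).continuousAt
  have hinW : ∀ (a : X), MapClusterPt (StrongDual.toWeakDual (inclusionInDoubleDual ℝ X a))
      atTop u → a ∈ W := by
    intro a ha
    by_contra haW
    obtain ⟨g, s, hg1, hg2⟩ := geometric_hahn_banach_closed_point W.convex hWc haW
    have hmem : g a ∈ Set.Iic s := (isClosed_Iic).mem_of_mapClusterPt (hclus a ha g)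
      (Eventually.of_forall fun n => (hg1 _ (hxW (φ n))).le)
    exact absurd hg2 (not_lt.mpr hmem)
  have hfa : ∀ (a : X), MapClusterPt (StrongDual.toWeakDual (inclusionInDoubleDual ℝ X a))
      atTop u → ∀ i, f i a = L i := by
    intro a ha i
    have h := hclus a ha (f i)
    have hne : NeBot (𝓝 (f i a) ⊓ 𝓝 (L i)) :=
      NeBot.mono h (inf_le_inf_left _ (hL' i))
    exact eq_of_nhds_neBot hne
  have huniq : ∀ a b : X, MapClusterPt (StrongDual.toWeakDual (inclusionInDoubleDual ℝ X a))
      atTop u → MapClusterPt (StrongDual.toWeakDual (inclusionInDoubleDual ℝ X b))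
      atTop u → a = b := by
    intro a b ha hb
    have hz : a - b ∈ closure c := hWsub (W.sub_mem (hinW a ha) (hinW b hb))
    have hfz : ∀ i, f i (a - b) = 0 := fun i => by
      rw [map_sub, hfa a ha, hfa b hb, sub_self]
    rw [← sub_eq_zero, ← norm_le_zero_iff]
    refine le_of_forall_pos_le_add fun ε hε => ?_
    obtain ⟨w, hw, hd⟩ := Metric.mem_closure_iff.mp hz (ε / 2) (half_pos hε)
    have h1 := (f ⟨w, hw⟩).le_of_opNorm_le (hf1 ⟨w, hw⟩) (w - (a - b))
    rw [map_sub, hfz, hf2, sub_zero, one_mul, norm_norm] at h1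
    have h2 : ‖a - b‖ ≤ ‖w‖ + ‖w - (a - b)‖ := by
      simpa using norm_sub_le w (w - (a - b))
    rw [dist_comm, dist_eq_norm] at hd
    simp only at h1
    linarith
  obtain ⟨ψ, -, hψ⟩ := hcomp.exists_mapClusterPt (u := u) (f := atTop)
    (tendsto_principal.mpr (Eventually.of_forall hmem))
  obtain ⟨a, ha⟩ := hrefl (WeakDual.toStrongDual ψ)
  have hψ' : ψ = StrongDual.toWeakDual (inclusionInDoubleDual ℝ X a) := by rw [ha]; rfl
  refine ⟨a, φ, hφ, fun g => ?_⟩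
  have ht : Tendsto u atTop (𝓝 ψ) := by
    refine hcomp.tendsto_nhds_of_unique_mapClusterPt (Eventually.of_forall hmem) ?_
    intro χ _ hχ
    obtain ⟨b, hb⟩ := hrefl (WeakDual.toStrongDual χ)
    have hχ' : χ = StrongDual.toWeakDual (inclusionInDoubleDual ℝ X b) := by rw [hb]; rfl
    rw [hψ', hχ', huniq b a (hχ' ▸ hχ) (hψ' ▸ hψ)]
  rw [hψ'] at ht
  exact ((WeakDual.eval_continuous g).tendsto _).comp ht

/-- Weakly null sequences are bounded. -/
theorem WeaklyNull.bounded {Y : Type*} [NormedAddCommGroup Y] [NormedSpace ℝ Y] {y : ℕ → Y}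
    (hy : WeaklyNull y) : ∃ M, ∀ n, ‖y n‖ ≤ M := by
  obtain ⟨C, hC⟩ := banach_steinhaus (g := fun n => NormedSpace.inclusionInDoubleDual ℝ Y (y n))
    (fun f => by
      obtain ⟨C, hC⟩ := (hy f).norm.bddAbove_range
      exact ⟨C, fun n => hC ⟨n, rfl⟩⟩)
  refine ⟨C, fun n => ?_⟩
  have h : ‖NormedSpace.inclusionInDoubleDual ℝ Y (y n)‖ = ‖y n‖ :=
    (NormedSpace.inclusionInDoubleDualLi ℝ (E := Y)).norm_map (y n)
  exact h ▸ hC n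

/-- Weakly null sequences in quotients of reflexive spaces have subsequences which lift to
weakly null sequences. -/
theorem exists_weaklyNull_lift {X : Type*} [NormedAddCommGroup X] [NormedSpace ℝ X]
    (hrefl : Function.Surjective (NormedSpace.inclusionInDoubleDual ℝ X))
    (Z : Submodule ℝ X) [hZ : IsClosed (Z : Set X)] (y : ℕ → X ⧸ Z) (hy : WeaklyNull y) :
    ∃ (x : ℕ → X) (φ : ℕ → ℕ), StrictMono φ ∧ WeaklyNull x ∧ ∀ n, Z.mkQ (x n) = y (φ n) := by
  obtain ⟨M, hM⟩ := hy.bounded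
  choose x hx1 hx2 using fun n => Submodule.Quotient.norm_mk_lt (y n) one_pos
  obtain ⟨a, φ, hφ, ha⟩ := exists_weak_subseq hrefl x (M + 1)
    (fun n => (hx2 n).le.trans (by linarith [hM n]))
  let q : X →L[ℝ] X ⧸ Z := Z.mkQ.mkContinuous 1 fun m => by
    rw [one_mul]; exact Submodule.Quotient.norm_mk_le Z m
  have hq : q a = 0 := by
    refine SeparatingDual.eq_zero_of_forall_dual_eq_zero (R := ℝ) fun g => ?_
    have h1 := ha (g.comp q)
    have h2 : Tendsto (fun n => (g.comp q) (x (φ n))) atTop (𝓝 0) := by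
      have h3 := (hy g).comp hφ.tendsto_atTop
      refine h3.congr fun n => ?_
      simp only [Function.comp_apply]
      rw [← hx1 (φ n)]
      rfl
    exact tendsto_nhds_unique h1 h2
  refine ⟨fun n => x (φ n) - a, φ, hφ, fun f => ?_, fun n => ?_⟩
  · simpa using (ha f).sub_const (f a)
  · have : Z.mkQ a = 0 := hq
    rw [map_sub, this, sub_zero]
    exact hx1 (φ n)

theorem norm_sum_le_lift {X : Type*} [NormedAddCommGroup X] [NormedSpace ℝ X]
    (Z : Submodule ℝ X) [hZ : IsClosed (Z : Set X)] (y : ℕ → X ⧸ Z) (x : ℕ → X)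
    (h : ∀ n, Z.mkQ (x n) = y n) (N : ℕ) :
    ‖∑ k ∈ Finset.range N, y k‖ ≤ ‖∑ k ∈ Finset.range N, x k‖ := by
  have : ∑ k ∈ Finset.range N, y k = Z.mkQ (∑ k ∈ Finset.range N, x k) := by
    rw [map_sum]; exact Finset.sum_congr rfl fun k _ => (h k).symm
  rw [this]
  exact Submodule.Quotient.norm_mk_le Z _

/-- Let `X` be a reflexive Banach space, `Z` a closed linear subspace and `X ⧸ Z` the quotient
Banach space with the quotient norm. If `X` is of (unconditional) Banach-Mazur type
`p ∈ [1,∞]`, then so is `X ⧸ Z`. -/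
theorem bmType_quotient (X : Type*) [NormedAddCommGroup X] [NormedSpace ℝ X] [CompleteSpace X]
    (hrefl : Function.Surjective (NormedSpace.inclusionInDoubleDual ℝ X))
    (Z : Submodule ℝ X) [hZ : IsClosed (Z : Set X)] (p : ℝ≥0∞) (hp : 1 ≤ p) :
    (BMType X p → BMType (X ⧸ Z) p) ∧ (BMUncondType X p → BMUncondType (X ⧸ Z) p) := by
  constructor
  · intro hX y hy
    obtain ⟨x, φ, hφ, hx, hxy⟩ := exists_weaklyNull_lift hrefl Z y hy
    obtain ⟨n, hn, C, hC, hb⟩ := hX x hx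
    exact ⟨φ ∘ n, hφ.comp hn, C, hC, fun N =>
      (norm_sum_le_lift Z _ (fun k => x (n k)) (fun k => hxy (n k)) N).trans (hb N)⟩
  · intro hX y hy
    obtain ⟨x, φ, hφ, hx, hxy⟩ := exists_weaklyNull_lift hrefl Z y hy
    obtain ⟨n, hn, hb⟩ := hX x hx
    refine ⟨φ ∘ n, hφ.comp hn, fun m hm => ?_⟩
    obtain ⟨C, hC, hb⟩ := hb m hm
    exact ⟨C, hC, fun N =>
      (norm_sum_le_lift Z _ (fun k => x (n (m k))) (fun k => hxy (n (m k))) N).trans (hb N)⟩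
end

section
/- Let X and Y be Banach spaces over ℝ and suppose there exists a bounded linear map T : X → Y and a constant c > 0 such that c·‖x‖ ≤ ‖Tx‖ for all x ∈ X (i.e., X is isomorphic to a closed subspace of Y). If Y is of Banach-Mazur type p ∈ [1,∞], then X is of Banach-Mazur type p. The analogous statement holds for the unconditional Banach-Mazur type. -/
open Filter Topology ENNReal

/-- Let `X`, `Y` be Banach spaces and suppose there is a bounded linear map `T : X → Y` with
`c * ‖x‖ ≤ ‖T x‖` for some `c > 0` and all `x` (i.e. `X` is isomorphic to a closed subspace
of `Y`). If `Y` is of (unconditional) Banach-Mazur type `p ∈ [1,∞]`, then so is `X`. -/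
theorem bmType_of_embedding (X Y : Type*) [NormedAddCommGroup X] [NormedSpace ℝ X]
    [CompleteSpace X] [NormedAddCommGroup Y] [NormedSpace ℝ Y] [CompleteSpace Y]
    (T : X →L[ℝ] Y) (c : ℝ) (hc : 0 < c) (hT : ∀ x : X, c * ‖x‖ ≤ ‖T x‖)
    (p : ℝ≥0∞) (hp : 1 ≤ p) :
    (BMType Y p → BMType X p) ∧ (BMUncondType Y p → BMUncondType X p) := by
  have hw : ∀ x : ℕ → X, WeaklyNull x → WeaklyNull (fun n => T (x n)) :=
    fun x hx f => hx (f.comp T)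
  have key : ∀ (y : ℕ → X), (∃ C : ℝ, 0 < C ∧
      ∀ N : ℕ, ‖∑ k ∈ Finset.range N, T (y k)‖ ≤ C * (N : ℝ) ^ (1 / p).toReal) →
      ∃ C : ℝ, 0 < C ∧
      ∀ N : ℕ, ‖∑ k ∈ Finset.range N, y k‖ ≤ C * (N : ℝ) ^ (1 / p).toReal := by
    rintro y ⟨C, hC, h⟩
    refine ⟨C / c, div_pos hC hc, fun N => ?_⟩
    have h1 := hT (∑ k ∈ Finset.range N, y k)
    rw [map_sum] at h1
    have h2 := h1.trans (h N)
    rw [div_mul_eq_mul_div, le_div_iff₀ hc, mul_comm]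
    exact h2
  refine ⟨fun hY x hx => ?_, fun hY x hx => ?_⟩
  · obtain ⟨n, hn, h⟩ := hY _ (hw x hx)
    exact ⟨n, hn, key (fun k => x (n k)) h⟩
  · obtain ⟨n, hn, h⟩ := hY _ (hw x hx)
    exact ⟨n, hn, fun m hm => key (fun k => x (n (m k))) (h m hm)⟩
end

section
/- Let p, q ∈ (1,∞) with p ≠ q. Then ℓ^p(ℕ) is not isomorphic to any closed subspace of ℓ^q(ℕ): there is no bounded linear map T : ℓ^p(ℕ,ℝ) → ℓ^q(ℕ,ℝ) for which there exists a constant c > 0 with c·‖x‖ ≤ ‖Tx‖ for all x. In particular, ℓ^p and ℓ^q are of incomparable linear dimension. -/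
open Filter Topology ENNReal

lemma growth_false (a B r s : ℝ) (ha : 0 < a) (hrs : r < s)
    (h : ∀ N : ℕ, a * (N : ℝ) ^ s ≤ B * (N : ℝ) ^ r) : False := by
  have h1 : Tendsto (fun N : ℕ => (N : ℝ) ^ (s - r)) atTop atTop :=
    (tendsto_rpow_atTop (sub_pos.2 hrs)).comp tendsto_natCast_atTop_atTop
  obtain ⟨N, hN, hN1⟩ := ((h1.eventually_gt_atTop (B / a)).and (eventually_ge_atTop 1)).exists
  have hNp : (0 : ℝ) < N := by exact_mod_cast hN1
  have h2 := h N
  have h3 : (N : ℝ) ^ s = (N : ℝ) ^ (s - r) * (N : ℝ) ^ r := by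
    rw [← Real.rpow_add hNp]; congr 1; ring
  rw [h3, ← mul_assoc] at h2
  have h4 := le_of_mul_le_mul_right h2 (Real.rpow_pos_of_pos hNp r)
  rw [div_lt_iff₀ ha] at hN
  linarith

lemma norm_sum_sign (p : ℝ≥0∞) [Fact (1 ≤ p)] (hp : 0 < p.toReal) (F : Finset ℕ) (a : ℕ → ℝ)
    (ha : ∀ k, |a k| = 1) :
    ‖∑ k ∈ F, lp.single (E := fun _ : ℕ => ℝ) p k (a k)‖ = (F.card : ℝ) ^ (1 / p.toReal) := by
  have h := lp.norm_sum_single (E := fun _ : ℕ => ℝ) hp a F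
  simp only [Real.norm_eq_abs, ha, Real.one_rpow, Finset.sum_const, nsmul_eq_mul, mul_one] at h
  rw [← h, one_div, Real.rpow_rpow_inv (norm_nonneg _) hp.ne']

lemma functional_null (p : ℝ≥0∞) [Fact (1 ≤ p)] (hp : 1 < p.toReal)
    (f : lp (fun _ : ℕ => ℝ) p →L[ℝ] ℝ) :
    Tendsto (fun k => f (lp.single (E := fun _ : ℕ => ℝ) p k 1)) atTop (𝓝 0) := by
  rw [Metric.tendsto_nhds]
  intro ε hε
  rw [← Nat.cofinite_eq_atTop, Filter.eventually_cofinite]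
  by_contra hinf
  have hinf : Set.Infinite {k | ¬ dist (f (lp.single (E := fun _ : ℕ => ℝ) p k 1)) 0 < ε} := hinf
  refine growth_false ε ‖f‖ (1 / p.toReal) 1 hε ?_ ?_
  · rw [div_lt_one (by linarith)]; exact hp
  intro N
  obtain ⟨F, hF, hcard⟩ := hinf.exists_subset_card_eq N
  set g : ℕ → ℝ := fun k => f (lp.single (E := fun _ : ℕ => ℝ) p k 1) with hg
  set a : ℕ → ℝ := fun k => if 0 ≤ g k then 1 else -1 with ha
  have ha1 : ∀ k, |a k| = 1 := by
    intro k; simp only [ha]; split_ifs <;> simp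
  have hag : ∀ k, a k * g k = |g k| := by
    intro k; simp only [ha]; split_ifs with h
    · rw [abs_of_nonneg h, one_mul]
    · rw [abs_of_neg (not_le.1 h)]; ring
  have hn := norm_sum_sign p (by linarith) F a ha1
  have hle := f.le_opNorm (∑ k ∈ F, lp.single (E := fun _ : ℕ => ℝ) p k (a k))
  rw [hn, hcard, map_sum] at hle
  have hs : ∀ k, f (lp.single (E := fun _ : ℕ => ℝ) p k (a k)) = |g k| := by
    intro k
    rw [← hag, hg]
    simp only
    rw [← smul_eq_mul, ← map_smul, ← lp.single_smul, smul_eq_mul, mul_one]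
  rw [Finset.sum_congr rfl (fun k _ => hs k)] at hle
  have hge : (F.card : ℝ) * ε ≤ ∑ k ∈ F, |g k| := by
    rw [← nsmul_eq_mul]
    apply Finset.card_nsmul_le_sum
    intro k hk
    have := hF hk
    simpa [hg, Real.dist_eq] using this
  rw [hcard] at hge
  rw [Real.rpow_one]
  calc ε * N = N * ε := mul_comm _ _
    _ ≤ _ := hge
    _ ≤ _ := le_abs_self _
    _ ≤ _ := hle

/-- splitting for finitely supported `x` -/
lemma split_finite (q : ℝ≥0∞) [Fact (1 ≤ q)] (hq : 0 < q.toReal)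
    (y : ℕ → lp (fun _ : ℕ => ℝ) q) (hy : ∀ i, Tendsto (fun k => y k i) atTop (𝓝 0))
    (x : lp (fun _ : ℕ => ℝ) q) (s : Finset ℕ) (hx : ∀ i, i ∉ s → x i = 0) :
    Tendsto (fun k => ‖x + y k‖ ^ q.toReal - ‖x‖ ^ q.toReal - ‖y k‖ ^ q.toReal) atTop (𝓝 0) := by
  have key : ∀ k, ‖x + y k‖ ^ q.toReal - ‖x‖ ^ q.toReal - ‖y k‖ ^ q.toReal =
      ∑ i ∈ s, (|x i + y k i| ^ q.toReal - |x i| ^ q.toReal - |y k i| ^ q.toReal) := by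
    intro k
    have h1 := ((lp.hasSum_norm hq (x + y k)).sub (lp.hasSum_norm hq x)).sub
      (lp.hasSum_norm hq (y k))
    refine h1.unique ?_
    apply hasSum_sum_of_ne_finset_zero
    intro i hi
    have := hx i hi
    simp [this, Real.zero_rpow hq.ne']
  simp_rw [key]
  have h0 : (0 : ℝ) = ∑ i ∈ s, (|x i + 0| ^ q.toReal - |x i| ^ q.toReal - |(0 : ℝ)| ^ q.toReal) := by
    simp [Real.zero_rpow hq.ne']
  rw [h0]
  apply tendsto_finsetSum
  intro i _
  refine Tendsto.sub (Tendsto.sub ?_ tendsto_const_nhds) ?_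
  · exact ((tendsto_const_nhds.add (hy i)).abs).rpow_const (Or.inr hq.le)
  · exact ((hy i).abs).rpow_const (Or.inr hq.le)

lemma split_gen (q : ℝ≥0∞) [Fact (1 ≤ q)] (hq' : q ≠ ∞) (hq : 0 < q.toReal)
    (y : ℕ → lp (fun _ : ℕ => ℝ) q) (hy : ∀ i, Tendsto (fun k => y k i) atTop (𝓝 0))
    (M : ℝ) (hM : ∀ k, ‖y k‖ ≤ M)
    (x : lp (fun _ : ℕ => ℝ) q) :
    Tendsto (fun k => ‖x + y k‖ ^ q.toReal - ‖x‖ ^ q.toReal - ‖y k‖ ^ q.toReal) atTop (𝓝 0) := by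
  rw [Metric.tendsto_nhds]
  intro ε hε
  have hM0 : 0 ≤ M := (norm_nonneg _).trans (hM 0)
  have huc : UniformContinuousOn (fun t : ℝ => t ^ q.toReal) (Set.Icc 0 (‖x‖ + 1 + M)) :=
    isCompact_Icc.uniformContinuousOn_of_continuous
      (Real.continuous_rpow_const hq.le).continuousOn
  rw [Metric.uniformContinuousOn_iff] at huc
  obtain ⟨η, hη, huc⟩ := huc (ε / 3) (by linarith)
  have hs := lp.hasSum_single hq' x
  obtain ⟨s, hs⟩ := (Metric.tendsto_nhds.1 hs (min η 1) (by positivity)).exists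
  set x' := ∑ i ∈ s, lp.single (E := fun _ : ℕ => ℝ) q i (x i) with hx'
  have hsupp : ∀ i, i ∉ s → x' i = 0 := by
    intro i hi
    rw [hx', lp.coeFn_sum, Finset.sum_apply]
    apply Finset.sum_eq_zero
    intro j hj
    have hij : i ≠ j := by rintro rfl; exact hi hj
    exact lp.single_apply_ne (E := fun _ : ℕ => ℝ) q j (x j) hij
  rw [dist_eq_norm, norm_sub_rev] at hs
  have hs1 : ‖x - x'‖ < η := hs.trans_le (min_le_left _ _)
  have hs2 : ‖x - x'‖ < 1 := hs.trans_le (min_le_right _ _)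
  have hxx : ‖x'‖ ≤ ‖x‖ + 1 := by
    have := norm_sub_norm_le x' x
    rw [norm_sub_rev] at this
    linarith
  filter_upwards [Metric.tendsto_nhds.1 (split_finite q hq y hy x' s hsupp) (ε / 3)
    (by linarith)] with k hk
  have hb : dist (‖x + y k‖ ^ q.toReal) (‖x' + y k‖ ^ q.toReal) < ε / 3 := by
    apply huc
    · exact ⟨norm_nonneg _, by linarith [norm_add_le x (y k), hM k]⟩
    · exact ⟨norm_nonneg _, by linarith [norm_add_le x' (y k), hM k]⟩
    · rw [Real.dist_eq]
      refine (abs_norm_sub_norm_le _ _).trans_lt ?_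
      rwa [add_sub_add_right_eq_sub]
  have hc : dist (‖x‖ ^ q.toReal) (‖x'‖ ^ q.toReal) < ε / 3 := by
    apply huc
    · exact ⟨norm_nonneg _, by linarith⟩
    · exact ⟨norm_nonneg _, by linarith⟩
    · rw [Real.dist_eq]
      exact (abs_norm_sub_norm_le _ _).trans_lt hs1
  rw [Real.dist_eq, abs_lt] at *
  constructor <;> linarith [hk.1, hk.2, hb.1, hb.2, hc.1, hc.2]

/-- For `p ≠ q` in `(1,∞)`, the space `ℓ^p(ℕ)` is not isomorphic to a closed subspace of
`ℓ^q(ℕ)`: there is no bounded linear map `T : ℓ^p → ℓ^q` admitting a constant `c > 0` with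
`c * ‖x‖ ≤ ‖T x‖` for all `x`. In particular, `ℓ^p` and `ℓ^q` are of incomparable linear
dimension. -/
theorem lp_not_embeds_lq (p q : ℝ≥0∞) [Fact (1 ≤ p)] [Fact (1 ≤ q)]
    (hp : 1 < p) (hp' : p < ∞) (hq : 1 < q) (hq' : q < ∞) (hpq : p ≠ q) :
    ¬ ∃ T : lp (fun _ : ℕ => ℝ) p →L[ℝ] lp (fun _ : ℕ => ℝ) q,
        ∃ c : ℝ, 0 < c ∧ ∀ x, c * ‖x‖ ≤ ‖T x‖ := by
  rintro ⟨T, c, hc, hT⟩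
  have hp1 : 1 < p.toReal := by
    rw [← ENNReal.toReal_one]; exact (ENNReal.toReal_lt_toReal (by simp) hp'.ne).2 hp
  have hq1 : 1 < q.toReal := by
    rw [← ENNReal.toReal_one]; exact (ENNReal.toReal_lt_toReal (by simp) hq'.ne).2 hq
  have hne : p.toReal ≠ q.toReal := fun h => hpq ((ENNReal.toReal_eq_toReal_iff' hp'.ne hq'.ne).1 h)
  have hp0 : 0 < p.toReal := by linarith
  have hq0 : 0 < q.toReal := by linarith
  set e : ℕ → lp (fun _ : ℕ => ℝ) p := fun k => lp.single (E := fun _ : ℕ => ℝ) p k 1 with he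
  have hen : ∀ F : Finset ℕ, ‖∑ k ∈ F, e k‖ = (F.card : ℝ) ^ (1 / p.toReal) := fun F =>
    norm_sum_sign p hp0 F (fun _ => 1) (by simp)
  have he1 : ∀ k, ‖e k‖ = 1 := fun k => by simpa using hen {k}
  set y : ℕ → lp (fun _ : ℕ => ℝ) q := fun k => T (e k) with hy
  have hyM : ∀ k, ‖y k‖ ≤ ‖T‖ := fun k => by simpa [he1] using T.le_opNorm (e k)
  have hyc : ∀ k, c ≤ ‖y k‖ := fun k => by simpa [he1] using hT (e k)
  have hynull : ∀ i, Tendsto (fun k => y k i) atTop (𝓝 0) := fun i =>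
    functional_null p hp1 ((lp.evalCLM ℝ (fun _ : ℕ => ℝ) q i).comp T)
  have hcq : 0 < c ^ q.toReal := Real.rpow_pos_of_pos hc _
  have hF : ∀ N : ℕ, ∃ F : Finset ℕ, F.card = N ∧
      c ^ q.toReal / 2 * N ≤ ‖∑ k ∈ F, y k‖ ^ q.toReal ∧
      ‖∑ k ∈ F, y k‖ ^ q.toReal ≤ (‖T‖ ^ q.toReal + c ^ q.toReal / 2) * N := by
    intro N
    induction N with
    | zero => exact ⟨∅, by simp, by simp [Real.zero_rpow hq0.ne'], by simp [Real.zero_rpow hq0.ne']⟩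
    | succ N ih =>
      obtain ⟨F, hcard, h1, h2⟩ := ih
      have hev := Metric.tendsto_nhds.1 (split_gen q hq'.ne hq0 y hynull ‖T‖ hyM (∑ k ∈ F, y k))
        (c ^ q.toReal / 2) (by linarith)
      have hnot : ∀ᶠ n in atTop, n ∉ F := by
        rw [← Nat.cofinite_eq_atTop]
        exact F.finite_toSet.eventually_cofinite_notMem
      obtain ⟨n, hn, hnF⟩ := (hev.and hnot).exists
      have hb1 : c ^ q.toReal ≤ ‖y n‖ ^ q.toReal := Real.rpow_le_rpow hc.le (hyc n) hq0.le
      have hb2 : ‖y n‖ ^ q.toReal ≤ ‖T‖ ^ q.toReal :=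
        Real.rpow_le_rpow (norm_nonneg _) (hyM n) hq0.le
      rw [Real.dist_eq, sub_zero, abs_lt] at hn
      refine ⟨insert n F, by rw [Finset.card_insert_of_notMem hnF, hcard], ?_, ?_⟩ <;>
      · rw [Finset.sum_insert hnF, add_comm (y n)]
        push_cast
        linarith [hn.1, hn.2]
  have hpw : ∀ N : ℕ, ((N : ℝ) ^ (1 / p.toReal)) ^ q.toReal = (N : ℝ) ^ (q.toReal / p.toReal) := by
    intro N
    rw [← Real.rpow_mul (Nat.cast_nonneg N)]; congr 1; ring
  rcases lt_or_gt_of_ne hne with h | h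
  · refine growth_false (c ^ q.toReal) (‖T‖ ^ q.toReal + c ^ q.toReal / 2) 1
      (q.toReal / p.toReal) hcq ((one_lt_div hp0).2 h) ?_
    intro N
    obtain ⟨F, hcard, -, h2⟩ := hF N
    have h3 := hT (∑ k ∈ F, e k)
    rw [hen, hcard, map_sum] at h3
    have h4 := Real.rpow_le_rpow (by positivity) h3 hq0.le
    rw [Real.mul_rpow hc.le (by positivity), hpw] at h4
    rw [Real.rpow_one]
    exact h4.trans h2
  · refine growth_false (c ^ q.toReal / 2) (‖T‖ ^ q.toReal) (q.toReal / p.toReal) 1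
      (by linarith) ((div_lt_one hp0).2 h) ?_
    intro N
    obtain ⟨F, hcard, h1, -⟩ := hF N
    have h3 := T.le_opNorm (∑ k ∈ F, e k)
    rw [hen, hcard, map_sum] at h3
    have h4 := Real.rpow_le_rpow (by positivity) h3 hq0.le
    rw [Real.mul_rpow (norm_nonneg _) (by positivity), hpw] at h4
    rw [Real.rpow_one]
    exact h1.trans h4
end

section
/- Let X₁ and X₂ be normed spaces over ℝ and p ∈ [1,∞]. The product X₁ × X₂, equipped with the norm ‖(x,y)‖ = ‖x‖ + ‖y‖ (equivalently, any standard product norm), is of unconditional Banach-Mazur type p if and only if both X₁ and X₂ are of unconditional Banach-Mazur type p. -/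
open Filter Topology ENNReal

theorem WeaklyNull.map_clm {X Y : Type*} [NormedAddCommGroup X] [NormedSpace ℝ X]
    [NormedAddCommGroup Y] [NormedSpace ℝ Y] {x : ℕ → X} (hx : WeaklyNull x) (T : X →L[ℝ] Y) :
    WeaklyNull (fun n => T (x n)) :=
  fun f => hx (f.comp T)

/-- The product `X₁ × X₂` of two normed spaces (with a standard product norm) is of
unconditional Banach-Mazur type `p ∈ [1,∞]` if and only if both `X₁` and `X₂` are of
unconditional Banach-Mazur type `p`. -/
theorem bmUncondType_prod (X₁ X₂ : Type*) [NormedAddCommGroup X₁] [NormedSpace ℝ X₁]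
    [NormedAddCommGroup X₂] [NormedSpace ℝ X₂] (p : ℝ≥0∞) (hp : 1 ≤ p) :
    BMUncondType (X₁ × X₂) p ↔ BMUncondType X₁ p ∧ BMUncondType X₂ p := by
  constructor
  · intro h
    constructor
    · intro x hx
      obtain ⟨n, hn, H⟩ := h _ (hx.map_clm (ContinuousLinearMap.inl ℝ X₁ X₂))
      refine ⟨n, hn, fun m hm => ?_⟩
      obtain ⟨C, hC, hb⟩ := H m hm
      refine ⟨C, hC, fun N => le_trans ?_ (hb N)⟩
      refine le_trans (le_of_eq ?_) (norm_fst_le _)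
      rw [Prod.fst_sum]
      rfl
    · intro x hx
      obtain ⟨n, hn, H⟩ := h _ (hx.map_clm (ContinuousLinearMap.inr ℝ X₁ X₂))
      refine ⟨n, hn, fun m hm => ?_⟩
      obtain ⟨C, hC, hb⟩ := H m hm
      refine ⟨C, hC, fun N => le_trans ?_ (hb N)⟩
      refine le_trans (le_of_eq ?_) (norm_snd_le _)
      rw [Prod.snd_sum]
      rfl
  · rintro ⟨h₁, h₂⟩ x hx
    obtain ⟨n, hn, H⟩ := h₁ _ (hx.map_clm (ContinuousLinearMap.fst ℝ X₁ X₂))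
    have hx₂ : WeaklyNull (fun k => (x (n k)).2) := fun f =>
      (hx.map_clm (ContinuousLinearMap.snd ℝ X₁ X₂) f).comp hn.tendsto_atTop
    obtain ⟨n', hn', H'⟩ := h₂ _ hx₂
    refine ⟨fun k => n (n' k), hn.comp hn', fun m hm => ?_⟩
    obtain ⟨C, hC, hb⟩ := H (fun k => n' (m k)) (hn'.comp hm)
    obtain ⟨C', hC', hb'⟩ := H' m hm
    refine ⟨max C C', lt_max_of_lt_left hC, fun N => ?_⟩
    have hN : 0 ≤ (N : ℝ) ^ (1 / p).toReal := by positivity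
    rw [Prod.norm_def, Prod.fst_sum, Prod.snd_sum]
    exact max_le ((hb N).trans (mul_le_mul_of_nonneg_right (le_max_left _ _) hN))
      ((hb' N).trans (mul_le_mul_of_nonneg_right (le_max_right _ _) hN))
end

section
/- Let X₁ be a normed space over ℝ of Banach-Mazur type p₁ ∈ [1,∞] and X₂ a normed space over ℝ of unconditional Banach-Mazur type p₂ ∈ [1,∞]. Then the product X₁ × X₂ (with the norm ‖(x,y)‖ = ‖x‖ + ‖y‖, equivalently any standard product norm) is of Banach-Mazur type min{p₁, p₂}. -/
open Filter Topology ENNReal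

/-- If `X₁` is of Banach-Mazur type `p₁ ∈ [1,∞]` and `X₂` is of unconditional Banach-Mazur
type `p₂ ∈ [1,∞]`, then the product `X₁ × X₂` (with a standard product norm) is of
Banach-Mazur type `min p₁ p₂`. -/
theorem bmType_prod_of_uncond (X₁ X₂ : Type*) [NormedAddCommGroup X₁] [NormedSpace ℝ X₁]
    [NormedAddCommGroup X₂] [NormedSpace ℝ X₂] (p₁ p₂ : ℝ≥0∞) (hp₁ : 1 ≤ p₁) (hp₂ : 1 ≤ p₂)
    (h₁ : BMType X₁ p₁) (h₂ : BMUncondType X₂ p₂) : BMType (X₁ × X₂) (min p₁ p₂) := by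
  intro x hx
  have hx1 : WeaklyNull (fun n => (x n).1) := fun f =>
    hx (f.comp (ContinuousLinearMap.fst ℝ X₁ X₂))
  have hx2 : WeaklyNull (fun n => (x n).2) := fun f =>
    hx (f.comp (ContinuousLinearMap.snd ℝ X₁ X₂))
  obtain ⟨n, hn, hn2⟩ := h₂ _ hx2
  have hx1n : WeaklyNull (fun k => (x (n k)).1) := fun f =>
    (hx1 f).comp hn.tendsto_atTop
  obtain ⟨m, hm, C₁, hC₁, hb₁⟩ := h₁ _ hx1n
  obtain ⟨C₂, hC₂, hb₂⟩ := hn2 m hm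
  refine ⟨fun k => n (m k), hn.comp hm, max C₁ C₂, lt_max_of_lt_left hC₁, fun N => ?_⟩
  rcases Nat.eq_zero_or_pos N with rfl | hN
  · simp only [Finset.range_zero, Finset.sum_empty, norm_zero]
    positivity
  have hN1 : (1 : ℝ) ≤ N := by exact_mod_cast hN
  have htop : (1 / min p₁ p₂) ≠ ⊤ := by
    have h : 1 ≤ min p₁ p₂ := le_min hp₁ hp₂
    have h0 : min p₁ p₂ ≠ 0 := (lt_of_lt_of_le one_pos h).ne'
    rw [one_div]
    exact ENNReal.inv_ne_top.2 h0
  have key : ∀ (p : ℝ≥0∞) (C : ℝ), min p₁ p₂ ≤ p → 0 < C → C ≤ max C₁ C₂ →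
      C * (N : ℝ) ^ (1 / p).toReal ≤ max C₁ C₂ * (N : ℝ) ^ (1 / min p₁ p₂).toReal := by
    intro p C hp hC hle
    refine mul_le_mul hle ?_ (by positivity) (hC.le.trans hle)
    exact Real.rpow_le_rpow_of_exponent_le hN1
      (ENNReal.toReal_mono htop (ENNReal.div_le_div_left hp 1))
  rw [Prod.norm_def, Prod.fst_sum, Prod.snd_sum]
  exact max_le ((hb₁ N).trans (key p₁ C₁ (min_le_left _ _) hC₁ (le_max_left _ _)))
    ((hb₂ N).trans (key p₂ C₂ (min_le_right _ _) hC₂ (le_max_right _ _)))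
end

section
/- For every p ∈ (1,∞), the space ℓ^p(ℕ,ℝ) is of unconditional Banach-Mazur type p: every sequence in ℓ^p converging weakly to 0 has a subsequence such that every further subsequence (y_ℓ) admits a constant C > 0 with ‖∑_{ℓ=1}^N y_ℓ‖_p ≤ C·N^{1/p} for all N ∈ ℕ. -/
open Filter Topology ENNReal

theorem WeaklyNull.exists_bound {X : Type*} [NormedAddCommGroup X] [NormedSpace ℝ X]
    {x : ℕ → X} (hx : WeaklyNull x) : ∃ M : ℝ, 0 ≤ M ∧ ∀ n, ‖x n‖ ≤ M := by
  have h : ∀ f : StrongDual ℝ X, ∃ C, ∀ i,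
      ‖(NormedSpace.inclusionInDoubleDualLi (E := X) ℝ (x i)) f‖ ≤ C := by
    intro f
    obtain ⟨C, hC⟩ := (hx f).norm.bddAbove_range
    exact ⟨C, fun i => hC ⟨i, rfl⟩⟩
  obtain ⟨C, hC⟩ := banach_steinhaus h
  have hC' : ∀ n, ‖x n‖ ≤ C := fun n => by
    simpa only [LinearIsometry.norm_map] using hC n
  exact ⟨C, (norm_nonneg _).trans (hC' 0), hC'⟩

/-- Norm estimate for gluing `y` on `s` with `x` off `s`. -/
theorem lp_glue_le (p : ℝ≥0∞) [Fact (1 ≤ p)] (hp0 : 0 < p.toReal)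
    (x y : lp (fun _ : ℕ => ℝ) p) (s : Finset ℕ) :
    ‖∑ i ∈ s, lp.single p i (y i) + (x - ∑ i ∈ s, lp.single p i (x i))‖ ^ p.toReal
      ≤ ‖y‖ ^ p.toReal + ‖x‖ ^ p.toReal := by
  set z : lp (fun _ : ℕ => ℝ) p :=
    ∑ i ∈ s, lp.single p i (y i) + (x - ∑ i ∈ s, lp.single p i (x i)) with hz
  have hzi : ∀ i ∈ s, z i = y i := by
    intro i hi
    have hT : ∀ f : ℕ → ℝ, (∑ j ∈ s, lp.single (E := fun _ : ℕ => ℝ) p j (f j)) i = f i := by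
      intro f
      have h1 : (∑ j ∈ s, lp.single (E := fun _ : ℕ => ℝ) p j (f j)) i
          = ∑ j ∈ s, (Pi.single j (f j) : ℕ → ℝ) i :=
        map_sum (lp.evalCLM ℝ (fun _ : ℕ => ℝ) p i) _ s
      rw [h1, Finset.sum_pi_single, if_pos hi]
    rw [hz, lp.coeFn_add, lp.coeFn_sub, Pi.add_apply, Pi.sub_apply, hT (fun j => y j),
      hT (fun j => x j)]
    ring
  have h1 := lp.norm_sub_norm_compl_sub_single hp0 z s
  have h2 := lp.norm_sub_norm_compl_sub_single hp0 x s
  have h3 := lp.norm_sub_norm_compl_sub_single hp0 y s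
  have h4 : ∑ i ∈ s, lp.single (E := fun _ : ℕ => ℝ) p i (z i) = ∑ i ∈ s, lp.single p i (y i) :=
    Finset.sum_congr rfl fun i hi => by rw [hzi i hi]
  have h5 : ∑ i ∈ s, ‖z i‖ ^ p.toReal = ∑ i ∈ s, ‖y i‖ ^ p.toReal :=
    Finset.sum_congr rfl fun i hi => by rw [hzi i hi]
  have h6 : z - ∑ i ∈ s, lp.single (E := fun _ : ℕ => ℝ) p i (z i)
      = x - ∑ i ∈ s, lp.single p i (x i) := by
    rw [h4, hz]; abel
  rw [h6, h5] at h1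
  have h7 : 0 ≤ ∑ i ∈ s, ‖x i‖ ^ p.toReal := Finset.sum_nonneg fun i _ => by positivity
  have h8 : 0 ≤ ‖y - ∑ i ∈ s, lp.single p i (y i)‖ ^ p.toReal := by positivity
  linarith

theorem lp_eventually_le (p : ℝ≥0∞) [Fact (1 ≤ p)] (hp' : p < ∞)
    {x : ℕ → lp (fun _ : ℕ => ℝ) p} (hx : WeaklyNull x) {M : ℝ} (hM0 : 0 ≤ M)
    (hM : ∀ n, ‖x n‖ ≤ M) (y : lp (fun _ : ℕ => ℝ) p) :
    ∀ᶠ n in atTop, ‖y + x n‖ ^ p.toReal ≤ ‖y‖ ^ p.toReal + (M ^ p.toReal + 1) := by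
  have hp0 : 0 < p.toReal := ENNReal.toReal_pos (zero_lt_one.trans_le Fact.out).ne' hp'.ne
  set A : ℝ := ‖y‖ ^ p.toReal + M ^ p.toReal with hA
  have hA0 : 0 ≤ A := by positivity
  set t : ℝ := A ^ (p.toReal)⁻¹ with ht
  have ht0 : 0 ≤ t := by positivity
  have htp : t ^ p.toReal = A := Real.rpow_inv_rpow hA0 hp0.ne'
  have hcont : Tendsto (fun e : ℝ => (t + e) ^ p.toReal) (𝓝 0) (𝓝 A) := by
    have : Continuous (fun e : ℝ => (t + e) ^ p.toReal) :=
      (continuous_const.add continuous_id).rpow_const fun _ => Or.inr hp0.le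
    simpa [htp] using this.tendsto 0
  have hev := hcont.eventually (gt_mem_nhds (show A < A + 1 by linarith))
  obtain ⟨δ, hδ, hball⟩ := Metric.eventually_nhds_iff.1 hev
  have hs : Tendsto (fun s : Finset ℕ => ∑ i ∈ s, lp.single p i (y i)) atTop (𝓝 y) :=
    lp.hasSum_single hp'.ne y
  obtain ⟨s, hs⟩ := (Metric.tendsto_nhds.1 hs (δ / 2) (by positivity)).exists
  rw [dist_comm, dist_eq_norm] at hs
  have hP : Tendsto (fun n => ∑ i ∈ s, lp.single (E := fun _ : ℕ => ℝ) p i (x n i)) atTop (𝓝 0) := by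
    have : ∀ i ∈ s, Tendsto (fun n => lp.single (E := fun _ : ℕ => ℝ) p i (x n i)) atTop (𝓝 0) := by
      intro i _
      have h1 : Tendsto (fun n => x n i) atTop (𝓝 0) :=
        hx (lp.evalCLM ℝ (fun _ : ℕ => ℝ) p i)
      have h2 := ((lp.isometry_single (E := fun _ : ℕ => ℝ) (p := p) i).continuous.tendsto 0).comp h1
      rw [lp.single_zero] at h2
      exact h2
    simpa using tendsto_finsetSum s this
  filter_upwards [Metric.tendsto_nhds.1 hP (δ / 2) (by positivity)] with n hn
  rw [dist_zero_right] at hn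
  set e := ‖y - ∑ i ∈ s, lp.single p i (y i)‖ + ‖∑ i ∈ s, lp.single p i (x n i)‖ with he
  have he0 : 0 ≤ e := by positivity
  have hg := lp_glue_le p hp0 (x n) y s
  have hMn : ‖x n‖ ^ p.toReal ≤ M ^ p.toReal :=
    Real.rpow_le_rpow (norm_nonneg _) (hM n) hp0.le
  have hzt : ‖∑ i ∈ s, lp.single p i (y i) + (x n - ∑ i ∈ s, lp.single p i (x n i))‖ ≤ t := by
    rw [← Real.rpow_le_rpow_iff (norm_nonneg _) ht0 hp0, htp]
    linarith
  have hle : ‖y + x n‖ ≤ t + e := by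
    have : y + x n = (∑ i ∈ s, lp.single p i (y i) + (x n - ∑ i ∈ s, lp.single p i (x n i)))
      + (y - ∑ i ∈ s, lp.single p i (y i)) + ∑ i ∈ s, lp.single p i (x n i) := by abel
    rw [this]
    refine (norm_add₃_le).trans ?_
    linarith
  have h1 : (t + e) ^ p.toReal < A + 1 := by
    apply hball
    rw [dist_zero_right, Real.norm_of_nonneg he0]
    linarith
  have h2 := Real.rpow_le_rpow (norm_nonneg _) hle hp0.le
  linarith

/-- For every `p ∈ (1,∞)`, the sequence space `ℓ^p(ℕ,ℝ)` is of unconditional Banach-Mazur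
type `p`. -/
theorem bmUncondType_lp (p : ℝ≥0∞) [Fact (1 ≤ p)] (hp : 1 < p) (hp' : p < ∞) :
    BMUncondType (lp (fun _ : ℕ => ℝ) p) p := by
  intro x hx
  have hp0 : 0 < p.toReal := ENNReal.toReal_pos (zero_lt_one.trans_le Fact.out).ne' hp'.ne
  obtain ⟨M, hM0, hM⟩ := hx.exists_bound
  have hφ : ∀ K : ℕ, ∃ a : ℕ, ∀ n ≥ a, ∀ F ∈ (Finset.range K).powerset,
      ‖∑ i ∈ F, x i + x n‖ ^ p.toReal ≤ ‖∑ i ∈ F, x i‖ ^ p.toReal + (M ^ p.toReal + 1) := by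
    intro K
    apply eventually_atTop.1
    rw [Filter.eventually_all_finset]
    intro F _
    exact lp_eventually_le p hp' hx hM0 hM _
  choose φ hφ using hφ
  let n : ℕ → ℕ := fun k => Nat.rec 0 (fun _ a => max (a + 1) (φ (a + 1))) k
  have hn1 : ∀ k, n (k + 1) = max (n k + 1) (φ (n k + 1)) := fun k => rfl
  have hn : StrictMono n := strictMono_nat_of_lt_succ fun k => by
    rw [hn1]; exact lt_of_lt_of_le (Nat.lt_succ_self _) (le_max_left _ _)
  refine ⟨n, hn, fun m hm => ?_⟩
  set B : ℝ := M ^ p.toReal + 1 with hB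
  have hB0 : 0 < B := by positivity
  have key : ∀ N : ℕ, ‖∑ k ∈ Finset.range N, x (n (m k))‖ ^ p.toReal ≤ N * B := by
    intro N
    induction N with
    | zero => simp [Real.zero_rpow hp0.ne']
    | succ N ih =>
      rw [Finset.sum_range_succ]
      have step : ‖∑ k ∈ Finset.range N, x (n (m k)) + x (n (m N))‖ ^ p.toReal
          ≤ ‖∑ k ∈ Finset.range N, x (n (m k))‖ ^ p.toReal + B := by
        rcases Nat.eq_zero_or_pos N with rfl | hN
        · have := Real.rpow_le_rpow (norm_nonneg _) (hM (n (m 0))) hp0.le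
          simp only [Finset.range_zero, Finset.sum_empty, zero_add, norm_zero,
            Real.zero_rpow hp0.ne']
          linarith
        · obtain ⟨j, hj⟩ : ∃ j, m N = j + 1 :=
            ⟨m N - 1, by have := hm.le_apply (x := N); omega⟩
          have hinj : Function.Injective (fun k => n (m k)) := (hn.comp hm).injective
          have hsum : ∑ i ∈ (Finset.range N).image (fun k => n (m k)), x i
              = ∑ k ∈ Finset.range N, x (n (m k)) :=
            Finset.sum_image fun a _ b _ h => hinj h
          have := hφ (n j + 1) (n (m N)) (by rw [hj, hn1]; exact le_max_right _ _)
            ((Finset.range N).image (fun k => n (m k))) (by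
              rw [Finset.mem_powerset]
              intro i hi
              obtain ⟨k, hk, rfl⟩ := Finset.mem_image.1 hi
              have h1 : m k < m N := hm (Finset.mem_range.1 hk)
              have h2 : n (m k) ≤ n j := hn.monotone (by omega)
              exact Finset.mem_range.2 (by omega))
          rwa [hsum] at this
      push_cast
      linarith
  refine ⟨B ^ (p.toReal)⁻¹, by positivity, fun N => ?_⟩
  have hq : (1 / p).toReal = (p.toReal)⁻¹ := by simp
  rw [hq, ← Real.mul_rpow hB0.le (Nat.cast_nonneg N),
    Real.le_rpow_inv_iff_of_pos (norm_nonneg _) (by positivity) hp0, mul_comm]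
  exact key N
end

section
/- The space c₀ of real sequences converging to 0, with the supremum norm, is of unconditional Banach-Mazur type ∞: every sequence in c₀ converging weakly to 0 has a subsequence such that every further subsequence (y_ℓ) admits a constant C > 0 with ‖∑_{ℓ=1}^N y_ℓ‖_∞ ≤ C for all N ∈ ℕ. -/
open Filter Topology ENNReal

theorem c0_coord_le (f : ZeroAtInftyContinuousMap ℕ ℝ) (j : ℕ) : |f j| ≤ ‖f‖ := by
  rw [← ZeroAtInftyContinuousMap.norm_toBCF_eq_norm]
  exact f.toBCF.norm_coe_le_norm j

theorem c0_norm_le (f : ZeroAtInftyContinuousMap ℕ ℝ) (C : ℝ) (hC : 0 ≤ C)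
    (h : ∀ j, |f j| ≤ C) : ‖f‖ ≤ C := by
  rw [← ZeroAtInftyContinuousMap.norm_toBCF_eq_norm]
  exact (BoundedContinuousFunction.norm_le hC).2 h

theorem weaklyNull_bdd {X : Type*} [NormedAddCommGroup X] [NormedSpace ℝ X] (x : ℕ → X)
    (hx : WeaklyNull x) : ∃ M : ℝ, 0 ≤ M ∧ ∀ n, ‖x n‖ ≤ M := by
  obtain ⟨M, hM⟩ := banach_steinhaus
    (g := fun n => NormedSpace.inclusionInDoubleDual ℝ X (x n)) (by
      intro f
      obtain ⟨C, hC⟩ := (hx f).norm.bddAbove_range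
      exact ⟨C, fun i => hC ⟨i, rfl⟩⟩)
  have h : ∀ n, ‖x n‖ ≤ M := fun n => by
    have := hM n
    rwa [show ‖NormedSpace.inclusionInDoubleDual ℝ X (x n)‖ = ‖x n‖ from
      (NormedSpace.inclusionInDoubleDualLi ℝ).norm_map (x n)] at this
  exact ⟨M, (norm_nonneg _).trans (h 0), h⟩

theorem c0_coord_tendsto (x : ℕ → ZeroAtInftyContinuousMap ℕ ℝ) (hx : WeaklyNull x) (j : ℕ) :
    Tendsto (fun n => x n j) atTop (𝓝 0) := by
  let L : ZeroAtInftyContinuousMap ℕ ℝ →ₗ[ℝ] ℝ :=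
    { toFun := fun f => f j
      map_add' := fun _ _ => rfl
      map_smul' := fun _ _ => rfl }
  exact hx (L.mkContinuous 1 (fun f => by rw [one_mul]; exact c0_coord_le f j))

theorem c0_tail (f : ZeroAtInftyContinuousMap ℕ ℝ) (ε : ℝ) (hε : 0 < ε) :
    ∃ p, ∀ j, p ≤ j → |f j| ≤ ε := by
  have h := f.zero_at_infty'
  rw [cocompact_eq_cofinite, Nat.cofinite_eq_atTop] at h
  obtain ⟨p, hp⟩ := Metric.tendsto_atTop.1 h ε hε
  exact ⟨p, fun j hj => by simpa using (hp j hj).le⟩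

theorem c0_subseq (x : ℕ → ZeroAtInftyContinuousMap ℕ ℝ) (hx : WeaklyNull x) :
    ∃ f : ℕ → ℕ × ℕ, ∀ a b, a < b → (f a).1 < (f b).1 ∧ (f a).2 < (f b).2 ∧
      ∀ j, |x (f a).1 j| ≤ (1 / 2 : ℝ) ^ (f a).2 ∨ |x (f b).1 j| ≤ (1 / 2 : ℝ) ^ (f b).2 := by
  obtain ⟨f, -, hf⟩ := exists_seq_of_forall_finset_exists (α := ℕ × ℕ) (fun _ => True)
    (fun u v => u.1 < v.1 ∧ u.2 < v.2 ∧
      ∀ j, |x u.1 j| ≤ (1 / 2 : ℝ) ^ u.2 ∨ |x v.1 j| ≤ (1 / 2 : ℝ) ^ v.2) (by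
    intro s _
    set e := s.sup Prod.snd + 1 with he
    have hev : ∀ᶠ n in atTop, ∀ u ∈ s, u.1 < n ∧
        ∀ j, |x u.1 j| ≤ (1 / 2 : ℝ) ^ u.2 ∨ |x n j| ≤ (1 / 2 : ℝ) ^ e := by
      rw [Filter.eventually_all_finset]
      intro u _
      obtain ⟨p, hp⟩ := c0_tail (x u.1) ((1 / 2 : ℝ) ^ u.2) (by positivity)
      have h2 : ∀ᶠ n in atTop, ∀ j ∈ Finset.range p, |x n j| ≤ (1 / 2 : ℝ) ^ e := by
        rw [Filter.eventually_all_finset]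
        intro j _
        have h3 := (c0_coord_tendsto x hx j).abs
        rw [abs_zero] at h3
        exact h3.eventually_le_const (by positivity)
      filter_upwards [h2, eventually_gt_atTop u.1] with n hn hn'
      refine ⟨hn', fun j => ?_⟩
      by_cases hj : p ≤ j
      · exact Or.inl (hp j hj)
      · exact Or.inr (hn j (Finset.mem_range.2 (not_le.1 hj)))
    obtain ⟨n, hn⟩ := hev.exists
    exact ⟨(n, e), trivial, fun u hu => ⟨(hn u hu).1,
      Nat.lt_succ_of_le (Finset.le_sup (f := Prod.snd) hu), (hn u hu).2⟩⟩)
  exact ⟨f, hf⟩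

/-- A sequence of reals in which at most one term exceeds the geometric bound. -/
theorem sum_bound (a : ℕ → ℝ) (M : ℝ) (hM : 0 ≤ M) (ha : ∀ k, |a k| ≤ M)
    (h : ∀ k l, k < l → |a k| ≤ (1 / 2 : ℝ) ^ k ∨ |a l| ≤ (1 / 2 : ℝ) ^ l) (N : ℕ) :
    |∑ k ∈ Finset.range N, a k| ≤ M + 2 := by
  have hg : ∑ k ∈ Finset.range N, (1 / 2 : ℝ) ^ k ≤ 2 := sum_geometric_two_le N
  have key : ∃ k0, ∀ k, k ≠ k0 → |a k| ≤ (1 / 2 : ℝ) ^ k := by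
    by_cases hb : ∃ k0, ¬ |a k0| ≤ (1 / 2 : ℝ) ^ k0
    · obtain ⟨k0, hk0⟩ := hb
      refine ⟨k0, fun k hk => ?_⟩
      rcases lt_or_gt_of_ne hk with hlt | hlt
      · exact (h k k0 hlt).resolve_right hk0
      · exact (h k0 k hlt).resolve_left hk0
    · push Not at hb
      exact ⟨0, fun k _ => hb k⟩
  obtain ⟨k0, hk0⟩ := key
  calc |∑ k ∈ Finset.range N, a k| ≤ ∑ k ∈ Finset.range N, |a k| :=
        Finset.abs_sum_le_sum_abs _ _
    _ ≤ ∑ k ∈ Finset.range N, ((if k = k0 then M else 0) + (1 / 2 : ℝ) ^ k) := by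
        refine Finset.sum_le_sum fun k _ => ?_
        have hp : (0 : ℝ) ≤ (1 / 2 : ℝ) ^ k := by positivity
        split_ifs with hk
        · linarith [ha k]
        · linarith [hk0 k hk]
    _ ≤ M + 2 := by
        rw [Finset.sum_add_distrib, Finset.sum_ite_eq']
        split_ifs <;> linarith

/-- The space `c₀` of real sequences converging to `0`, with the supremum norm (realized as
the space of functions `ℕ → ℝ` vanishing at infinity), is of unconditional Banach-Mazur
type `∞`. -/
theorem bmUncondType_c0 : BMUncondType (ZeroAtInftyContinuousMap ℕ ℝ) ∞ := by
  intro x hx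
  obtain ⟨M, hM0, hM⟩ := weaklyNull_bdd x hx
  obtain ⟨f, hf⟩ := c0_subseq x hx
  refine ⟨fun k => (f k).1, fun a b hab => (hf a b hab).1, fun m hm => ⟨M + 2, by linarith, ?_⟩⟩
  intro N
  have hs : StrictMono fun k => (f (m k)).2 := fun a b hab => (hf _ _ (hm hab)).2.1
  have hpow : ∀ k, (1 / 2 : ℝ) ^ (f (m k)).2 ≤ (1 / 2 : ℝ) ^ k := fun k =>
    pow_le_pow_of_le_one (by norm_num) (by norm_num) (hs.le_apply (x := k))
  have hexp : ((1 : ℝ≥0∞) / ∞).toReal = 0 := by simp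
  rw [hexp, Real.rpow_zero, mul_one]
  refine c0_norm_le _ _ (by linarith) fun j => ?_
  have hsum : (∑ k ∈ Finset.range N, x (f (m k)).1) j
      = ∑ k ∈ Finset.range N, x (f (m k)).1 j := by
    induction N with
    | zero => rfl
    | succ n ih => rw [Finset.sum_range_succ, Finset.sum_range_succ, ← ih]; rfl
  rw [hsum]
  refine sum_bound (fun k => x (f (m k)).1 j) M hM0
    (fun k => (c0_coord_le _ j).trans (hM _)) (fun k l hkl => ?_) N
  exact ((hf _ _ (hm hkl)).2.2 j).imp (fun h => h.trans (hpow k)) (fun h => h.trans (hpow l))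
end

section
/- Let p ∈ (2,∞). Then the space L^p(0,1) of (equivalence classes of) real-valued p-integrable functions on the unit interval with Lebesgue measure is of unconditional Banach-Mazur type 2, and is not of Banach-Mazur type q for any q ∈ (2,∞]. Consequently (together with ℓ^p being of Banach-Mazur type p and not of type q for q > p), ℓ^p(ℕ,ℝ) and L^p(0,1) are not isomorphic as Banach spaces for any p ∈ (2,∞). -/
open Filter Topology ENNReal

namespace BMAux

/-- Extraction of a subsequence all of whose further subsequences are good. -/
lemma extract {X : Type*} [AddCommMonoid X] (x : ℕ → X) (R : X → ℕ → Prop)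
    (h : ∀ S, ∀ᶠ m in atTop, R S m) :
    ∃ n : ℕ → ℕ, StrictMono n ∧ ∀ m : ℕ → ℕ, StrictMono m → ∀ k,
      R (∑ i ∈ Finset.range k, x (n (m i))) (n (m k)) := by
  have h1 : ∀ j : ℕ, ∃ g : ℕ, ∀ m ≥ g, ∀ A ∈ (Finset.range j).powerset, R (∑ i ∈ A, x i) m := by
    intro j
    have := (Filter.eventually_all_finset (l := atTop) (Finset.range j).powerset
      (p := fun A m => R (∑ i ∈ A, x i) m)).2 (fun A _ => h _)
    exact eventually_atTop.1 this
  choose g hg using h1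
  let n : ℕ → ℕ := fun k => Nat.rec (g 0) (fun _ a => max (a + 1) (g (a + 1))) k
  have n0 : n 0 = g 0 := rfl
  have ns : ∀ k, n (k+1) = max (n k + 1) (g (n k + 1)) := fun k => rfl
  have hn : StrictMono n := strictMono_nat_of_lt_succ (fun k => by
    rw [ns]; exact lt_of_lt_of_le (Nat.lt_succ_self _) (le_max_left _ _))
  refine ⟨n, hn, fun m hm k => ?_⟩
  have hnm : StrictMono (fun i => n (m i)) := hn.comp hm
  have hsum : ∑ i ∈ Finset.range k, x (n (m i))
      = ∑ i ∈ (Finset.range k).map ⟨fun i => n (m i), hnm.injective⟩, x i := by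
    simp
  rw [hsum]
  rcases Nat.eq_zero_or_pos (m k) with h0 | h0
  · have hk : k = 0 := by
      have := hm.id_le k
      simp at this; omega
    subst hk
    refine hg 0 _ ?_ _ (by simp)
    rw [h0, n0]
  · obtain ⟨j, hj⟩ := Nat.exists_eq_succ_of_ne_zero h0.ne'
    refine hg (n j + 1) _ ?_ _ ?_
    · rw [hj, Nat.succ_eq_add_one, ns]; exact le_max_right _ _
    · rw [Finset.mem_powerset]
      intro a ha
      simp only [Finset.mem_map, Finset.mem_range, Function.Embedding.coeFn_mk] at ha
      obtain ⟨i, hi, rfl⟩ := ha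
      have : m i ≤ j := by have := hm hi; omega
      have := hn.monotone this
      simp; omega

lemma bounded_of_weaklyNull {X : Type*} [NormedAddCommGroup X] [NormedSpace ℝ X]
    (x : ℕ → X) (hx : WeaklyNull x) : ∃ M : ℝ, 1 ≤ M ∧ ∀ n, ‖x n‖ ≤ M := by
  have := banach_steinhaus (g := fun n => NormedSpace.inclusionInDoubleDual ℝ X (x n)) (by
    intro f
    obtain ⟨C, hC⟩ := (hx f).norm.bddAbove_range
    refine ⟨C, fun n => ?_⟩
    have := hC ⟨n, rfl⟩
    simpa using this)
  obtain ⟨C, hC⟩ := this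
  refine ⟨max C 1, le_max_right _ _, fun n => ?_⟩
  refine le_trans ?_ (le_max_left _ _)
  have h2 := hC n
  rwa [show ‖NormedSpace.inclusionInDoubleDual ℝ X (x n)‖ = ‖x n‖ from
    (NormedSpace.inclusionInDoubleDualLi (E := X) ℝ).norm_map (x n)] at h2

lemma bernoulli_pow (N : ℝ) (hN : 0 < N) (r : ℝ) (hr : 1 ≤ r) :
    N ^ r + r * N ^ (r - 1) ≤ (N + 1) ^ r := by
  have h := one_add_mul_self_le_rpow_one_add (s := 1 / N) (by have : 0 ≤ 1 / N := by positivity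
                                                              linarith) hr
  have : (N + 1) ^ r = N ^ r * (1 + 1 / N) ^ r := by
    rw [← Real.mul_rpow hN.le (by positivity)]; congr 1; field_simp
  rw [this, Real.rpow_sub_one hN.ne']
  have h2 := mul_le_mul_of_nonneg_left h (Real.rpow_nonneg hN.le r)
  refine le_trans (le_of_eq ?_) h2
  field_simp

lemma growth (P K : ℝ) (hP : 2 < P) (hK : 0 ≤ K) :
    ∃ B : ℝ, 0 < B ∧ ∀ a : ℕ → ℝ, a 0 = 0 → (∀ n, 0 ≤ a n) →
      (∀ n, a (n + 1) ^ P ≤ a n ^ P + K * (1 + a n ^ (P - 2))) →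
      ∀ n, a n ≤ B * (n : ℝ) ^ (1 / 2 : ℝ) := by
  refine ⟨1 + 2 * K, by positivity, fun a ha0 ha h => ?_⟩
  set B := 1 + 2 * K with hB
  have hB1 : 1 ≤ B := by linarith
  have hB0 : 0 < B := by linarith
  have key : ∀ n : ℕ, a n ^ P ≤ B ^ P * (n : ℝ) ^ (P / 2) := by
    intro n
    induction n with
    | zero => simp [ha0, Real.zero_rpow (show P ≠ 0 by linarith),
        Real.zero_rpow (show P / 2 ≠ 0 by linarith)]
    | succ n ih =>
      refine (h n).trans ?_
      have hBB : B ^ P = B ^ (P - 2) * B ^ 2 := by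
        rw [← Real.rpow_natCast B 2, ← Real.rpow_add hB0]; norm_num
      have hBp : 1 ≤ B ^ (P - 2) := Real.one_le_rpow hB1 (by linarith)
      rcases Nat.eq_zero_or_pos n with hn | hn
      · subst hn
        simp only [ha0, Real.zero_rpow (show P ≠ 0 by linarith),
          Real.zero_rpow (show P - 2 ≠ 0 by linarith)]
        simp
        rw [hBB]
        nlinarith
      · have hn' : (1 : ℝ) ≤ n := by exact_mod_cast hn
        have han : a n ≤ B * (n : ℝ) ^ (1 / 2 : ℝ) := by
          rw [← Real.rpow_le_rpow_iff (ha n) (by positivity) (show 0 < P by linarith),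
            Real.mul_rpow hB0.le (by positivity), ← Real.rpow_mul (by positivity)]
          convert ih using 3; ring
        have han2 : a n ^ (P - 2) ≤ B ^ (P - 2) * (n : ℝ) ^ (P / 2 - 1) := by
          have := Real.rpow_le_rpow (ha n) han (show 0 ≤ P - 2 by linarith)
          rw [Real.mul_rpow hB0.le (by positivity), ← Real.rpow_mul (by positivity)] at this
          convert this using 3; ring
        have hb := bernoulli_pow n (by linarith) (P / 2) (by linarith)
        push_cast
        have hnp : 1 ≤ (n : ℝ) ^ (P / 2 - 1) := Real.one_le_rpow hn' (by linarith)
        set t := (n : ℝ) ^ (P / 2 - 1)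
        set b := B ^ (P - 2)
        have h1 : 1 + a n ^ (P - 2) ≤ 2 * (b * t) := by nlinarith
        have h2 : K * (1 + a n ^ (P - 2)) ≤ K * (2 * (b * t)) := mul_le_mul_of_nonneg_left h1 hK
        have h3 : K * (2 * (b * t)) ≤ B ^ P * (P / 2 * t) := by
          rw [hBB]
          have : 2 * K ≤ B ^ 2 * (P / 2) := by nlinarith
          have hbt : 0 ≤ b * t := by positivity
          nlinarith
        have h4 := mul_le_mul_of_nonneg_left hb (show 0 ≤ B ^ P by positivity)
        linarith
  intro n
  rw [← Real.rpow_le_rpow_iff (ha n) (by positivity) (show 0 < P by linarith),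
    Real.mul_rpow hB0.le (by positivity), ← Real.rpow_mul (by positivity)]
  convert key n using 3; ring

lemma uncond_of_smooth {X : Type*} [NormedAddCommGroup X] [NormedSpace ℝ X] (P C : ℝ)
    (hP : 2 < P) (hC : 0 ≤ C)
    (h : ∀ S : X, ∃ φ : X →L[ℝ] ℝ, ∀ x, ‖S + x‖ ^ P ≤
      ‖S‖ ^ P + φ x + C * (‖x‖ ^ P + ‖S‖ ^ (P - 2) * ‖x‖ ^ 2)) : BMUncondType X 2 := by
  intro x hx
  obtain ⟨M, hM, hxM⟩ := bounded_of_weaklyNull x hx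
  choose φ hφ using h
  obtain ⟨n, hn, hR⟩ := extract x (fun S m => φ S (x m) ≤ 1) (fun S => by
    have := (hx (φ S)).eventually (ge_mem_nhds zero_lt_one)
    exact this)
  refine ⟨n, hn, fun m hm => ?_⟩
  have hMP : 1 ≤ M ^ P := Real.one_le_rpow hM (by linarith)
  obtain ⟨B, hB, hgr⟩ := growth P (1 + C * (M ^ P + M ^ 2)) hP (by positivity)
  refine ⟨B, hB, fun N => ?_⟩
  have := hgr (fun N => ‖∑ k ∈ Finset.range N, x (n (m k))‖) (by simp) (fun _ => norm_nonneg _) (by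
    intro N
    simp only [Finset.sum_range_succ]
    refine (hφ _ _).trans ?_
    have h1 := hR m hm N
    set S := ∑ k ∈ Finset.range N, x (n (m k))
    have h2 : ‖x (n (m N))‖ ^ P ≤ M ^ P :=
      Real.rpow_le_rpow (norm_nonneg _) (hxM _) (by linarith)
    have h3 : ‖x (n (m N))‖ ^ 2 ≤ M ^ 2 := pow_le_pow_left₀ (norm_nonneg _) (hxM _) 2
    have h4 : 0 ≤ ‖S‖ ^ (P - 2) := by positivity
    have h5 : ‖S‖ ^ (P - 2) * ‖x (n (m N))‖ ^ 2 ≤ ‖S‖ ^ (P - 2) * M ^ 2 :=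
      mul_le_mul_of_nonneg_left h3 h4
    have h6 := mul_le_mul_of_nonneg_left (add_le_add h2 h5) hC
    have h7 : 0 ≤ C * M ^ 2 := by positivity
    have h8 : 0 ≤ C * M ^ P * ‖S‖ ^ (P - 2) := by positivity
    nlinarith) N
  simpa using this

lemma BMType_of_uncond_step {X : Type*} [NormedAddCommGroup X] [NormedSpace ℝ X] (p : ℝ≥0∞)
    (P : ℝ) (hpP : p.toReal = P) (hP : 0 < P)
    (h : ∀ x : ℕ → X, WeaklyNull x → ∃ K : ℝ, 0 < K ∧ ∀ S, ∀ᶠ m in atTop,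
      ‖S + x m‖ ^ P ≤ ‖S‖ ^ P + K) : BMType X p := by
  intro x hx
  obtain ⟨K, hK, hs⟩ := h x hx
  obtain ⟨n, hn, hR⟩ := extract x (fun S m => ‖S + x m‖ ^ P ≤ ‖S‖ ^ P + K) hs
  refine ⟨n, hn, K ^ (1 / P), by positivity, fun N => ?_⟩
  have key : ∀ N : ℕ, ‖∑ k ∈ Finset.range N, x (n k)‖ ^ P ≤ K * N := by
    intro N
    induction N with
    | zero => simp [Real.zero_rpow hP.ne']
    | succ N ih =>
      rw [Finset.sum_range_succ]
      refine (hR id strictMono_id N).trans ?_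
      push_cast
      simp only [id]
      linarith
  have h1 : (1 / p).toReal = 1 / P := by simp [hpP]
  rw [h1, ← Real.mul_rpow hK.le (by positivity), ← Real.rpow_le_rpow_iff (norm_nonneg _) (by positivity) hP,
    ← Real.rpow_mul (by positivity), one_div_mul_cancel hP.ne', Real.rpow_one]
  exact key N

lemma BMType_congr {X Y : Type*} [NormedAddCommGroup X] [NormedSpace ℝ X]
    [NormedAddCommGroup Y] [NormedSpace ℝ Y] (e : X ≃L[ℝ] Y) (p : ℝ≥0∞) (h : BMType Y p) :
    BMType X p := by
  intro x hx
  obtain ⟨n, hn, C, hC, hN⟩ := h (fun k => e (x k)) (fun f => hx (f.comp (e : X →L[ℝ] Y)))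
  refine ⟨n, hn, (‖(e.symm : Y →L[ℝ] X)‖ + 1) * C, by positivity, fun N => ?_⟩
  have h1 : ∑ k ∈ Finset.range N, x (n k) = (e.symm : Y →L[ℝ] X) (∑ k ∈ Finset.range N, e (x (n k))) := by
    simp
  rw [h1]
  refine ((e.symm : Y →L[ℝ] X).le_opNorm _).trans ?_
  rw [mul_assoc]
  have := hN N
  gcongr
  linarith

lemma lp_type (p : ℝ≥0∞) [Fact (1 ≤ p)] (hp' : p < ∞) : BMType (lp (fun _ : ℕ => ℝ) p) p := by
  have hp1 : 1 ≤ p := Fact.out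
  have hP : 0 < p.toReal := ENNReal.toReal_pos (zero_lt_one.trans_le hp1).ne' hp'.ne
  refine BMType_of_uncond_step p p.toReal rfl hP fun x hx => ?_
  obtain ⟨M, hM, hxM⟩ := bounded_of_weaklyNull x hx
  set P := p.toReal with hPdef
  have hMP : 0 ≤ M ^ P := by positivity
  refine ⟨M ^ P + 1, by positivity, fun S => ?_⟩
  -- choice of ε
  obtain ⟨ε, hε, hεle⟩ : ∃ ε > 0, ((‖S‖ ^ P + M ^ P) ^ (1 / P) + 2 * ε) ^ P
      ≤ ‖S‖ ^ P + (M ^ P + 1) := by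
    have hc : Tendsto (fun ε : ℝ => ((‖S‖ ^ P + M ^ P) ^ (1 / P) + 2 * ε) ^ P) (𝓝[>] 0)
        (𝓝 (((‖S‖ ^ P + M ^ P) ^ (1 / P) + 2 * 0) ^ P)) := by
      refine Tendsto.mono_left ?_ nhdsWithin_le_nhds
      refine Tendsto.rpow_const ?_ (Or.inr hP.le)
      exact (continuous_const.add (continuous_const.mul continuous_id)).tendsto 0
    rw [mul_zero, add_zero, ← Real.rpow_mul (by positivity), one_div_mul_cancel hP.ne',
      Real.rpow_one] at hc
    have h1 := hc.eventually (ge_mem_nhds (show ‖S‖ ^ P + M ^ P < ‖S‖ ^ P + (M ^ P + 1) by linarith))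
    obtain ⟨ε, h2, h3⟩ := (h1.and self_mem_nhdsWithin).exists
    exact ⟨ε, h3, h2⟩
  obtain ⟨F, hF⟩ : ∃ F : Finset ℕ, ‖S - ∑ i ∈ F, lp.single p i (S i)‖ < ε := by
    have := (lp.hasSum_single hp'.ne S)
    have h2 := (Metric.tendsto_nhds.1 this) ε hε
    obtain ⟨F, hF⟩ := h2.exists
    refine ⟨F, ?_⟩
    rwa [dist_comm, dist_eq_norm] at hF
  have hcoord : ∀ i, Tendsto (fun m => x m i) atTop (𝓝 0) := fun i =>
    hx (lp.evalCLM ℝ (fun _ : ℕ => ℝ) p i)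
  have hPx : Tendsto (fun m => ‖∑ i ∈ F, lp.single p i (x m i)‖) atTop (𝓝 0) := by
    have : Tendsto (fun m => ∑ i ∈ F, lp.single (E := fun _ : ℕ => ℝ) p i (x m i)) atTop (𝓝 (∑ i ∈ F, lp.single p i (0 : ℝ))) := by
      refine tendsto_finsetSum _ fun i _ => ?_
      exact ((lp.singleContinuousAddMonoidHom (fun _ : ℕ => ℝ) p i).continuous.tendsto 0).comp (hcoord i)
    have := this.norm
    simpa using this
  filter_upwards [hPx.eventually (gt_mem_nhds hε)] with m hm
  set PS := ∑ i ∈ F, lp.single p i (S i) with hPS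
  set Px := ∑ i ∈ F, lp.single p i (x m i) with hPxd
  refine le_trans ?_ hεle
  refine Real.rpow_le_rpow (norm_nonneg _) ?_ hP.le
  have hy : ‖PS + (x m - Px)‖ ≤ (‖S‖ ^ P + M ^ P) ^ (1 / P) := by
    rw [← Real.rpow_le_rpow_iff (norm_nonneg _) (by positivity) hP,
      ← Real.rpow_mul (by positivity), one_div_mul_cancel hP.ne', Real.rpow_one]
    have hval : ∀ i ∈ F, (PS + (x m - Px)) i = S i := by
      intro i hi
      have hs : ∀ f : lp (fun _ : ℕ => ℝ) p,
          (∑ i ∈ F, lp.single (E := fun _ : ℕ => ℝ) p i (f i)) i = f i := by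
        intro f
        rw [lp.coeFn_sum, Finset.sum_apply, Finset.sum_eq_single i]
        · exact lp.single_apply_self _ _ _
        · intro j _ hj
          exact lp.single_apply_ne _ _ _ hj.symm
        · exact fun h => absurd hi h
      rw [lp.coeFn_add, lp.coeFn_sub, Pi.add_apply, Pi.sub_apply, hPS, hPxd, hs, hs]
      ring
    have h1 := lp.norm_compl_sum_single hP (PS + (x m - Px)) F
    have h2 : ∑ i ∈ F, lp.single p i ((PS + (x m - Px)) i) = PS :=
      Finset.sum_congr rfl fun i hi => by rw [hval i hi]
    have h3 : ∑ i ∈ F, ‖(PS + (x m - Px)) i‖ ^ P = ∑ i ∈ F, ‖S i‖ ^ P :=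
      Finset.sum_congr rfl fun i hi => by rw [hval i hi]
    rw [h2, h3, add_sub_cancel_left] at h1
    have h4 := lp.norm_compl_sum_single hP (x m) F
    have h5 : 0 ≤ ∑ i ∈ F, ‖x m i‖ ^ P := Finset.sum_nonneg fun i _ => by positivity
    have h6 := lp.sum_rpow_le_norm_rpow hP S F
    have h7 : ‖x m‖ ^ P ≤ M ^ P := Real.rpow_le_rpow (norm_nonneg _) (hxM _) hP.le
    linarith
  calc ‖S + x m‖ = ‖(S - PS) + (PS + (x m - Px)) + Px‖ := by congr 1; abel
    _ ≤ ‖S - PS‖ + ‖PS + (x m - Px)‖ + ‖Px‖ := norm_add₃_le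
    _ ≤ _ := by linarith

lemma young_tangent (r : ℝ) (hr : 1 < r) (u a : ℝ) (hu : 0 ≤ u) (ha : 0 ≤ a) :
    r * (u ^ (r - 1) * a) ≤ (r - 1) * u ^ r + a ^ r := by
  have hpq := (Real.HolderConjugate.conjExponent hr)
  have h := Real.young_inequality_of_nonneg ha (Real.rpow_nonneg hu (r - 1)) hpq
  rw [← Real.rpow_mul hu, Real.conjExponent, mul_div_cancel₀ _ (by linarith : r - 1 ≠ 0)] at h
  have h2 := mul_le_mul_of_nonneg_left h (show 0 ≤ r by linarith)
  have h3 : r * (a ^ r / r + u ^ r / (r / (r - 1))) = (r - 1) * u ^ r + a ^ r := by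
    have : r - 1 ≠ 0 := by linarith
    field_simp
    ring
  linarith

lemma rpow_pm2 (P : ℝ) (hP : 2 < P) (u : ℝ) (hu : 0 ≤ u) : u ^ (P - 2) * u = u ^ (P - 1) := by
  rw [← Real.rpow_add_one' hu (by linarith)]; congr 1; ring

lemma rpow_pm1 (P : ℝ) (hP : 2 < P) (u : ℝ) (hu : 0 ≤ u) : u ^ (P - 1) * u = u ^ P := by
  rw [← Real.rpow_add_one' hu (by linarith)]; congr 1; ring

lemma lip (P : ℝ) (hP : 2 < P) (u a : ℝ) :
    (|u| ^ (P - 2) * u - |a| ^ (P - 2) * a) * (u - a)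
      ≤ (P - 1) * (|u| ^ (P - 2) + |a| ^ (P - 2)) * (u - a) ^ 2 := by
  wlog h : a ≤ u generalizing u a
  · have := this a u (by linarith); linarith
  have main : |u| ^ (P - 2) * u - |a| ^ (P - 2) * a
      ≤ (P - 1) * (|u| ^ (P - 2) + |a| ^ (P - 2)) * (u - a) := by
    have hpos : ∀ a u : ℝ, 0 ≤ a → a ≤ u → |u| ^ (P - 2) * u - |a| ^ (P - 2) * a
      ≤ (P - 1) * (|u| ^ (P - 2) + |a| ^ (P - 2)) * (u - a) := by
      intro a u ha h
      have hu : 0 ≤ u := ha.trans h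
      rw [abs_of_nonneg ha, abs_of_nonneg hu]
      have h1 := young_tangent (P - 1) (by linarith) u a hu ha
      rw [← rpow_pm2 P hP u hu, ← rpow_pm2 P hP a ha, show P - 1 - 1 = P - 2 by ring] at h1
      have h2 : 0 ≤ (P - 1) * a ^ (P - 2) * (u - a) :=
        mul_nonneg (mul_nonneg (by linarith) (by positivity)) (by linarith)
      nlinarith
    rcases le_total 0 a with ha | ha
    · exact hpos a u ha h
    · rcases le_total 0 u with hu | hu
      · have hU : 0 ≤ |u| ^ (P - 2) := by positivity
        have hA : 0 ≤ |a| ^ (P - 2) := by positivity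
        have h1 := mul_nonneg hU (neg_nonneg.2 ha)
        have h2 := mul_nonneg hA hu
        have h3 : (|u| ^ (P - 2) + |a| ^ (P - 2)) * (u - a) ≤
          (P - 1) * ((|u| ^ (P - 2) + |a| ^ (P - 2)) * (u - a)) :=
          le_mul_of_one_le_left (mul_nonneg (by positivity) (by linarith)) (by linarith)
        nlinarith
      · have := hpos (-u) (-a) (by linarith) (by linarith)
        rw [abs_neg, abs_neg] at this
        linarith
  have := mul_le_mul_of_nonneg_right main (show 0 ≤ u - a by linarith)
  linarith

lemma pw (P : ℝ) (hP : 2 < P) (a b : ℝ) :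
    |a + b| ^ P ≤ |a| ^ P + P * (|a| ^ (P - 2) * a * b) +
      P * (P - 1) * (2 ^ (P - 2) + 1) * (|b| ^ P + |a| ^ (P - 2) * b ^ 2) := by
  have habs : ∀ u : ℝ, |u| ^ P = |u| ^ (P - 2) * u ^ 2 := by
    intro u
    rw [← rpow_pm1 P hP _ (abs_nonneg u), ← rpow_pm2 P hP _ (abs_nonneg u), mul_assoc,
      ← sq, sq_abs]
  set u := a + b with hu
  have h1 : |u| ^ P - |a| ^ P ≤ P * (|u| ^ (P - 2) * u * b) := by
    have h := young_tangent P (by linarith) |u| |a| (abs_nonneg _) (abs_nonneg _)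
    rw [← rpow_pm2 P hP _ (abs_nonneg u)] at h
    have h2 : u * a ≤ |u| * |a| := by rw [← abs_mul]; exact le_abs_self _
    have h3 := mul_le_mul_of_nonneg_left h2 (show 0 ≤ P * |u| ^ (P - 2) by positivity)
    have h4 : b = u - a := by rw [hu]; ring
    have h5 := habs u
    rw [h4]
    nlinarith
  have h2 := lip P hP u a
  rw [show u - a = b by rw [hu]; ring] at h2
  have h3 : |u| ^ (P - 2) ≤ 2 ^ (P - 2) * (|a| ^ (P - 2) + |b| ^ (P - 2)) := by
    have e : |u| ≤ 2 * max |a| |b| := by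
      have := abs_add_le a b
      have := le_max_left |a| |b|
      have := le_max_right |a| |b|
      linarith
    refine (Real.rpow_le_rpow (abs_nonneg _) e (by linarith)).trans ?_
    rw [Real.mul_rpow (by norm_num) (by positivity)]
    refine mul_le_mul_of_nonneg_left ?_ (by positivity)
    rcases max_choice |a| |b| with h | h <;> rw [h]
    · have : 0 ≤ |b| ^ (P - 2) := by positivity
      linarith
    · have : 0 ≤ |a| ^ (P - 2) := by positivity
      linarith
  have h4 : |u| ^ (P - 2) + |a| ^ (P - 2) ≤ (2 ^ (P - 2) + 1) * (|a| ^ (P - 2) + |b| ^ (P - 2)) := by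
    have : 0 ≤ |b| ^ (P - 2) := by positivity
    linarith
  have h5 := mul_le_mul_of_nonneg_left h4 (show 0 ≤ (P - 1) * b ^ 2 from
    mul_nonneg (by linarith) (sq_nonneg _))
  have h6 : (|u| ^ (P - 2) * u - |a| ^ (P - 2) * a) * b ≤
      (P - 1) * (2 ^ (P - 2) + 1) * (|b| ^ P + |a| ^ (P - 2) * b ^ 2) := by
    rw [habs b]; linarith
  have h7 := mul_le_mul_of_nonneg_left h6 (show 0 ≤ P by linarith)
  linarith

open MeasureTheory

lemma norm_rpow_Lp {α : Type*} [MeasurableSpace α] {μ : Measure α} (p : ℝ≥0∞) (hp : 2 < p)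
    (hp' : p < ∞) (f : Lp ℝ p μ) : ‖f‖ ^ p.toReal = ∫ t, |f t| ^ p.toReal ∂μ := by
  have hp0 : p ≠ 0 := (lt_trans (by norm_num) hp).ne'
  have hP : 0 < p.toReal := ENNReal.toReal_pos hp0 hp'.ne
  have hnn : 0 ≤ ∫ t, |f t| ^ p.toReal ∂μ := integral_nonneg fun t => by positivity
  rw [Lp.norm_def, (Lp.memLp f).eLpNorm_eq_integral_rpow_norm hp0 hp'.ne]
  simp only [Real.norm_eq_abs]
  rw [ENNReal.toReal_ofReal (by positivity), ← Real.rpow_mul hnn, inv_mul_cancel₀ hP.ne',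
    Real.rpow_one]

lemma Lp_smooth {α : Type*} [MeasurableSpace α] {μ : Measure α} (p : ℝ≥0∞) [Fact (1 ≤ p)]
    (hp : 2 < p) (hp' : p < ∞) : ∃ C : ℝ, 0 ≤ C ∧ ∀ S : Lp ℝ p μ, ∃ φ : Lp ℝ p μ →L[ℝ] ℝ, ∀ x,
      ‖S + x‖ ^ p.toReal ≤ ‖S‖ ^ p.toReal + φ x
        + C * (‖x‖ ^ p.toReal + ‖S‖ ^ (p.toReal - 2) * ‖x‖ ^ 2) := by
  have hp0 : p ≠ 0 := (lt_trans (by norm_num) hp).ne'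
  obtain ⟨P, hPp⟩ : ∃ P, P = p.toReal := ⟨_, rfl⟩
  have hP : 2 < P := by
    rw [hPp]; simpa using (ENNReal.toReal_lt_toReal (by norm_num) hp'.ne).2 hp
  have hpP : p = ENNReal.ofReal P := by rw [hPp, ENNReal.ofReal_toReal hp'.ne]
  have hnorm := norm_rpow_Lp (μ := μ) p hp hp'
  have hInt : ∀ f : Lp ℝ p μ, Integrable (fun t => |f t| ^ P) μ := fun f => by
    have := (Lp.memLp f).integrable_norm_rpow hp0 hp'.ne
    rwa [← hPp] at this
  rw [← hPp] at hnorm ⊢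
  refine ⟨P * (P - 1) * (2 ^ (P - 2) + 1), mul_nonneg (mul_nonneg (by linarith) (by linarith))
    (by positivity), fun S => ?_⟩
  -- the functional
  set q : ℝ≥0∞ := ENNReal.ofReal (P / (P - 1)) with hq
  have hqc : p.HolderConjugate q := by
    rw [hpP, hq]
    exact (Real.HolderConjugate.conjExponent (by linarith : 1 < P)).ennrealOfReal
  have hq1 : Fact (1 ≤ q) := ⟨by
    rw [hq, ← ENNReal.ofReal_one]; apply ENNReal.ofReal_le_ofReal
    rw [le_div_iff₀ (by linarith)]; linarith⟩
  have hmS := (Lp.memLp S)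
  have hG : MemLp (fun t => |S t| ^ (P - 2) * S t) q μ := by
    have h1 := hmS.norm_rpow_div (ENNReal.ofReal (P - 1))
    rw [ENNReal.toReal_ofReal (by linarith)] at h1
    rw [hq, ENNReal.ofReal_div_of_pos (by linarith), ← hpP]
    refine h1.mono ?_ (Eventually.of_forall fun t => ?_)
    · exact (((hmS.1.norm.aemeasurable.pow_const (P - 2))).mul hmS.1.aemeasurable).aestronglyMeasurable
    · rw [norm_mul, Real.norm_eq_abs, Real.norm_eq_abs, Real.norm_eq_abs,
        abs_of_nonneg (show 0 ≤ |S t| ^ (P - 2) by positivity),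
        abs_of_nonneg (show 0 ≤ |S t| ^ (P - 1) by positivity), rpow_pm2 P hP _ (abs_nonneg _)]
  let B : ℝ →L[ℝ] ℝ →L[ℝ] ℝ := ContinuousLinearMap.mul ℝ ℝ
  have hqc' : q.HolderConjugate p := hqc.symm
  let φ : Lp ℝ p μ →L[ℝ] ℝ := P • (B.lpPairing μ q p (hG.toLp _))
  have hφ : ∀ x : Lp ℝ p μ, φ x = ∫ t, P * (|S t| ^ (P - 2) * S t * x t) ∂μ := by
    intro x
    have h1 : φ x = P * (B.lpPairing μ q p (hG.toLp _) x) := rfl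
    rw [h1, ContinuousLinearMap.lpPairing_eq_integral, ← integral_const_mul]
    refine integral_congr_ae ?_
    filter_upwards [hG.coeFn_toLp] with t ht
    simp only [B, ContinuousLinearMap.mul_apply', ht]
  refine ⟨φ, fun x => ?_⟩
  have hmx := Lp.memLp x
  have hIntφ : Integrable (fun t => P * (|S t| ^ (P - 2) * S t * x t)) μ := by
    refine Integrable.const_mul ?_ P
    exact hG.integrable_mul hmx
  -- Hölder
  have hc : (P / (P - 2)).HolderConjugate (P / 2) := by
    rw [Real.holderConjugate_iff]
    constructor
    · rw [lt_div_iff₀ (by linarith)]; linarith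
    · have : P - 2 ≠ 0 := by linarith
      field_simp
      ring
  have hU : MemLp (fun t => |S t| ^ (P - 2)) (ENNReal.ofReal (P / (P - 2))) μ := by
    have h1 := hmS.norm_rpow_div (ENNReal.ofReal (P - 2))
    rw [ENNReal.toReal_ofReal (by linarith)] at h1
    rw [ENNReal.ofReal_div_of_pos (by linarith), ← hpP]
    exact h1
  have hV : MemLp (fun t => x t ^ 2) (ENNReal.ofReal (P / 2)) μ := by
    have h1 := hmx.norm_rpow_div (ENNReal.ofReal 2)
    rw [ENNReal.toReal_ofReal (by norm_num)] at h1
    rw [ENNReal.ofReal_div_of_pos (by norm_num), ← hpP]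
    simpa using h1
  have hIntUV : Integrable (fun t => |S t| ^ (P - 2) * x t ^ 2) μ := by
    have : ENNReal.HolderConjugate (ENNReal.ofReal (P / (P - 2))) (ENNReal.ofReal (P / 2)) :=
      hc.ennrealOfReal
    exact hU.integrable_mul hV
  have hH : ∫ t, |S t| ^ (P - 2) * x t ^ 2 ∂μ ≤ ‖S‖ ^ (P - 2) * ‖x‖ ^ 2 := by
    refine (integral_mul_le_Lp_mul_Lq_of_nonneg hc (Eventually.of_forall fun t => by positivity)
      (Eventually.of_forall fun t => by positivity) hU hV).trans (le_of_eq ?_)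
    congr 1
    · have : ∀ t, (|S t| ^ (P - 2)) ^ (P / (P - 2)) = |S t| ^ P := fun t => by
        rw [← Real.rpow_mul (abs_nonneg _), mul_div_cancel₀ _ (by linarith : P - 2 ≠ 0)]
      simp_rw [this]
      rw [← hnorm, ← Real.rpow_mul (norm_nonneg _)]
      congr 1
      field_simp
    · have : ∀ t, (x t ^ 2) ^ (P / 2) = |x t| ^ P := fun t => by
        rw [← sq_abs, ← Real.rpow_natCast, ← Real.rpow_mul (abs_nonneg _)]
        congr 1
        push_cast
        field_simp
      simp_rw [this]
      rw [← hnorm, ← Real.rpow_mul (norm_nonneg _), ← Real.rpow_natCast]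
      congr 1
      push_cast
      field_simp
  set C := P * (P - 1) * (2 ^ (P - 2) + 1) with hC
  have hC0 : 0 ≤ C := mul_nonneg (mul_nonneg (by linarith) (by linarith)) (by positivity)
  have hle : ‖S + x‖ ^ P ≤ ∫ t, (|S t| ^ P + P * (|S t| ^ (P - 2) * S t * x t)
      + C * (|x t| ^ P + |S t| ^ (P - 2) * x t ^ 2)) ∂μ := by
    rw [hnorm]
    refine integral_mono_ae (hInt _) (((hInt S).add hIntφ).add (((hInt x).add hIntUV).const_mul C)) ?_
    filter_upwards [Lp.coeFn_add S x] with t ht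
    rw [ht]
    exact pw P hP (S t) (x t)
  have e1 : ∫ t, (|S t| ^ P + P * (|S t| ^ (P - 2) * S t * x t)
      + C * (|x t| ^ P + |S t| ^ (P - 2) * x t ^ 2)) ∂μ = ‖S‖ ^ P + φ x + C * (‖x‖ ^ P +
        ∫ t, |S t| ^ (P - 2) * x t ^ 2 ∂μ) := by
    have i1 : Integrable (fun t => |S t| ^ P + P * (|S t| ^ (P - 2) * S t * x t)) μ :=
      (hInt S).add hIntφ
    have i2 : Integrable (fun t => C * (|x t| ^ P + |S t| ^ (P - 2) * x t ^ 2)) μ :=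
      ((hInt x).add hIntUV).const_mul C
    rw [integral_add i1 i2,
      integral_add (hInt S) hIntφ, integral_const_mul C, integral_add (hInt x) hIntUV, hφ, hnorm, hnorm]
  rw [e1] at hle
  refine hle.trans ?_
  gcongr

/-- Lebesgue measure on the unit interval. -/
noncomputable abbrev μI : Measure ℝ := (volume : Measure ℝ).restrict (Set.Ioo 0 1)

instance : IsProbabilityMeasure μI := ⟨by simp [μI]⟩

/-- The cosine system. -/
noncomputable def cs (n : ℕ) (t : ℝ) : ℝ := Real.cos (Real.pi * (n + 1) * t)

lemma cs_cont (n : ℕ) : Continuous (cs n) := by unfold cs; fun_prop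

lemma cs_le (n : ℕ) (t : ℝ) : |cs n t| ≤ 1 := Real.abs_cos_le_one _

lemma cs_memLp (p : ℝ≥0∞) (n : ℕ) : MemLp (cs n) p μI :=
  MemLp.of_bound (cs_cont n).aestronglyMeasurable 1 (Eventually.of_forall fun t => cs_le n t)

lemma cs_int (k : ℤ) : ∫ t, Real.cos (Real.pi * k * t) ∂μI = if k = 0 then 1 else 0 := by
  rw [← integral_Ioc_eq_integral_Ioo, ← intervalIntegral.integral_of_le zero_le_one]
  split_ifs with h
  · simp [h]
  · have hk : Real.pi * (k : ℝ) ≠ 0 := mul_ne_zero Real.pi_ne_zero (by exact_mod_cast h)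
    rw [intervalIntegral.integral_comp_mul_left (fun s => Real.cos s) hk, integral_cos]
    simp [mul_comm Real.pi, Real.sin_int_mul_pi]

lemma cs_orth (n m : ℕ) : ∫ t, cs n t * cs m t ∂μI = if n = m then 1 / 2 else 0 := by
  have h : ∀ t, cs n t * cs m t = 1 / 2 * (Real.cos (Real.pi * ((n - m : ℤ) : ℤ) * t)
      + Real.cos (Real.pi * ((n + m + 2 : ℤ) : ℤ) * t)) := by
    intro t
    unfold cs
    push_cast
    rw [show Real.pi * ((n : ℝ) - m) * t = Real.pi * (n + 1) * t - Real.pi * (m + 1) * t by ring,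
      show Real.pi * ((n : ℝ) + m + 2) * t = Real.pi * (n + 1) * t + Real.pi * (m + 1) * t by ring,
      Real.cos_sub, Real.cos_add]
    ring
  have hi : ∀ k : ℤ, Integrable (fun t => Real.cos (Real.pi * k * t)) μI := fun k => by
    rw [← memLp_one_iff_integrable]
    exact MemLp.of_bound (by fun_prop) 1 (Eventually.of_forall fun t => Real.abs_cos_le_one _)
  simp_rw [h]
  rw [integral_const_mul, integral_add (hi _) (hi _), cs_int, cs_int, if_neg (by omega : ¬ (n + m + 2 : ℤ) = 0)]
  by_cases hnm : n = m
  · simp [hnm]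
  · rw [if_neg (by omega), if_neg hnm]; simp

lemma cs_sq (A : Finset ℕ) (σ : ℕ → ℝ) (hσ : ∀ k, σ k ^ 2 = 1) :
    ∫ t, (∑ k ∈ A, σ k * cs k t) ^ 2 ∂μI = A.card / 2 := by
  have hi : ∀ k j, Integrable (fun t => σ k * σ j * (cs k t * cs j t)) μI := fun k j => by
    refine Integrable.const_mul ?_ _
    exact (cs_memLp 2 k).integrable_mul (cs_memLp 2 j)
  have h : ∀ t, (∑ k ∈ A, σ k * cs k t) ^ 2
      = ∑ k ∈ A, ∑ j ∈ A, σ k * σ j * (cs k t * cs j t) := by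
    intro t
    rw [sq, Finset.sum_mul_sum]
    refine Finset.sum_congr rfl fun k _ => Finset.sum_congr rfl fun j _ => by ring
  simp_rw [h]
  rw [integral_finsetSum _ (fun k _ => integrable_finsetSum _ fun j _ => hi k j)]
  have : ∀ k ∈ A, ∫ t, ∑ j ∈ A, σ k * σ j * (cs k t * cs j t) ∂μI = 1 / 2 := by
    intro k hk
    rw [integral_finsetSum _ (fun j _ => hi k j)]
    simp_rw [integral_const_mul, cs_orth]
    rw [Finset.sum_eq_single k]
    · have := hσ k
      rw [if_pos rfl, ← sq, this, one_mul]
    · intro j _ hj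
      rw [if_neg hj.symm, mul_zero]
    · exact fun h => absurd hk h
  rw [Finset.sum_congr rfl this]
  simp [div_eq_mul_inv]

/-- The cosine system in `L^p`. -/
noncomputable def rs (p : ℝ≥0∞) (n : ℕ) : Lp ℝ p μI := (cs_memLp p n).toLp

lemma rs_sum (p : ℝ≥0∞) (A : Finset ℕ) (σ : ℕ → ℝ) :
    (∑ k ∈ A, σ k • rs p k : Lp ℝ p μI) =ᵐ[μI] fun t => ∑ k ∈ A, σ k * cs k t := by
  classical
  induction A using Finset.induction_on with
  | empty =>
    filter_upwards [Lp.coeFn_zero ℝ p μI] with t ht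
    rw [Finset.sum_empty, Finset.sum_empty, ht, Pi.zero_apply]
  | insert a A ha ih =>
    rw [Finset.sum_insert ha]
    filter_upwards [ih, Lp.coeFn_add (σ a • rs p a) (∑ k ∈ A, σ k • rs p k),
      Lp.coeFn_smul (σ a) (rs p a), (cs_memLp p a).coeFn_toLp] with t h1 h2 h3 h4
    rw [h2, Finset.sum_insert ha, Pi.add_apply, h1, h3, Pi.smul_apply, smul_eq_mul]
    unfold rs
    rw [h4]

lemma rs_upper (p : ℝ≥0∞) (hp : 2 < p) (hp' : p < ∞) (A : Finset ℕ) (σ : ℕ → ℝ)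
    (hσ : ∀ k, σ k ^ 2 = 1) :
    ‖∑ k ∈ A, σ k • rs p k‖ ^ p.toReal ≤ (A.card : ℝ) ^ (p.toReal - 1) := by
  have hP : 2 < p.toReal := by
    simpa using (ENNReal.toReal_lt_toReal (by norm_num) hp'.ne).2 hp
  set P := p.toReal
  rw [norm_rpow_Lp p hp hp']
  have hσ1 : ∀ k, |σ k| = 1 := fun k => by
    have := hσ k
    rw [← sq_abs] at this
    exact (pow_eq_one_iff_of_nonneg (abs_nonneg _) two_ne_zero).1 this
  have hb : ∀ t, |∑ k ∈ A, σ k * cs k t| ≤ A.card := fun t => by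
    refine (Finset.abs_sum_le_sum_abs _ _).trans ?_
    have : ∀ k ∈ A, |σ k * cs k t| ≤ 1 := fun k _ => by
      rw [abs_mul, hσ1, one_mul]; exact cs_le k t
    simpa using Finset.sum_le_sum this
  have hcont : Continuous fun t => ∑ k ∈ A, σ k * cs k t :=
    continuous_finsetSum _ fun k _ => continuous_const.mul (cs_cont k)
  calc ∫ t, |(∑ k ∈ A, σ k • rs p k : Lp ℝ p μI) t| ^ P ∂μI
      = ∫ t, |∑ k ∈ A, σ k * cs k t| ^ P ∂μI := by
        refine integral_congr_ae ?_
        filter_upwards [rs_sum p A σ] with t ht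
        rw [ht]
    _ ≤ ∫ t, (A.card : ℝ) ^ (P - 2) * (∑ k ∈ A, σ k * cs k t) ^ 2 ∂μI := by
        refine integral_mono_of_nonneg (Eventually.of_forall fun t => by positivity) ?_
          (Eventually.of_forall fun t => ?_)
        · refine Integrable.const_mul ?_ _
          have : MemLp (fun t => ∑ k ∈ A, σ k * cs k t) 2 μI :=
            MemLp.of_bound hcont.aestronglyMeasurable A.card (Eventually.of_forall hb)
          exact this.integrable_sq
        · simp only
          rw [← rpow_pm1 P hP _ (abs_nonneg _), ← rpow_pm2 P hP _ (abs_nonneg _), mul_assoc,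
            ← sq, sq_abs]
          exact mul_le_mul_of_nonneg_right (Real.rpow_le_rpow (abs_nonneg _) (hb t) (by linarith))
            (sq_nonneg _)
    _ = (A.card : ℝ) ^ (P - 2) * (A.card / 2) := by
        rw [integral_const_mul, cs_sq A σ hσ]
    _ ≤ (A.card : ℝ) ^ (P - 1) := by
        rw [← rpow_pm2 P hP _ (by positivity)]
        refine mul_le_mul_of_nonneg_left ?_ (by positivity)
        have : (0 : ℝ) ≤ A.card := by positivity
        linarith

lemma rs_lower (p : ℝ≥0∞) (hp : 2 < p) (A : Finset ℕ) :
    ((A.card : ℝ) / 2) ^ (1 / 2 : ℝ) ≤ ‖∑ k ∈ A, rs p k‖ := by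
  have h0 := rs_sum p A (fun _ => 1)
  simp only [one_smul, one_mul] at h0
  set F : Lp ℝ p μI := ∑ k ∈ A, rs p k
  have h1 := eLpNorm_le_eLpNorm_of_exponent_le (μ := μI) hp.le (Lp.memLp F).1
  have hm : MemLp F 2 μI := (Lp.memLp F).mono_exponent hp.le
  rw [hm.eLpNorm_eq_integral_rpow_norm (by norm_num) (by norm_num)] at h1
  have h2 : ∫ t, ‖F t‖ ^ (2 : ℝ≥0∞).toReal ∂μI = A.card / 2 := by
    rw [← cs_sq A (fun _ => 1) (by simp)]
    refine integral_congr_ae ?_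
    filter_upwards [h0] with t ht
    simp [ht]
  rw [h2, ENNReal.ofReal_le_iff_le_toReal (Lp.memLp F).2.ne, ← Lp.norm_def] at h1
  simpa using h1

lemma rs_weak (p : ℝ≥0∞) [Fact (1 ≤ p)] (hp : 2 < p) (hp' : p < ∞) : WeaklyNull (rs p) := by
  intro f
  have hP : 2 < p.toReal := by
    simpa using (ENNReal.toReal_lt_toReal (by norm_num) hp'.ne).2 hp
  by_contra hcon
  rw [Metric.tendsto_atTop] at hcon
  push Not at hcon
  obtain ⟨δ, hδ, hcon⟩ := hcon
  set I : Set ℕ := {n | δ ≤ |f (rs p n)|} with hI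
  have hinf : I.Infinite := by
    rw [Set.infinite_iff_exists_gt]
    intro a
    obtain ⟨n, hn, h⟩ := hcon (a + 1)
    refine ⟨n, ?_, by omega⟩
    rw [Real.dist_eq, sub_zero] at h
    exact h
  set P := p.toReal with hPdef
  let σ : ℕ → ℝ := fun k => if 0 ≤ f (rs p k) then 1 else -1
  have hσ : ∀ k, σ k ^ 2 = 1 := fun k => by
    simp only [σ]; split_ifs <;> norm_num
  have hσf : ∀ k, σ k * f (rs p k) = |f (rs p k)| := fun k => by
    simp only [σ]; split_ifs with h
    · rw [one_mul, abs_of_nonneg h]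
    · rw [abs_of_neg (by linarith)]; ring
  have key : ∀ N : ℕ, 0 < N → δ ^ P * N ≤ ‖f‖ ^ P := by
    intro N hN
    obtain ⟨A, hAI, hA⟩ := hinf.exists_subset_card_eq N
    have h1 := rs_upper p hp hp' A σ hσ
    have h2 : δ * N ≤ ‖f‖ * ‖∑ k ∈ A, σ k • rs p k‖ := by
      have h3 : f (∑ k ∈ A, σ k • rs p k) = ∑ k ∈ A, |f (rs p k)| := by
        rw [map_sum]
        exact Finset.sum_congr rfl fun k _ => by rw [map_smul, smul_eq_mul, hσf]
      have h4 : (A.card : ℝ) * δ ≤ ∑ k ∈ A, |f (rs p k)| := by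
        rw [← nsmul_eq_mul]
        exact Finset.card_nsmul_le_sum _ _ _ fun k hk => hAI hk
      rw [← h3, hA] at h4
      have := (le_abs_self _).trans (f.le_opNorm (∑ k ∈ A, σ k • rs p k))
      linarith
    have hN0 : (0 : ℝ) < N := by exact_mod_cast hN
    have h5 := Real.rpow_le_rpow (by positivity) h2 (show 0 ≤ P by linarith)
    rw [Real.mul_rpow hδ.le hN0.le, Real.mul_rpow (norm_nonneg _) (norm_nonneg _)] at h5
    rw [hA] at h1
    have h6 : ‖f‖ ^ P * ‖∑ k ∈ A, σ k • rs p k‖ ^ P ≤ ‖f‖ ^ P * (N : ℝ) ^ (P - 1) :=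
      mul_le_mul_of_nonneg_left h1 (by positivity)
    have h7 := h5.trans h6
    rw [← rpow_pm1 P hP _ hN0.le] at h7
    have hpos : 0 < (N : ℝ) ^ (P - 1) := by positivity
    refine le_of_mul_le_mul_right ?_ hpos
    linarith
  have hδP : 0 < δ ^ P := by positivity
  obtain ⟨N, hN⟩ := exists_nat_gt (‖f‖ ^ P / δ ^ P)
  have hN0 : 0 < N := by
    have : (0 : ℝ) < N := lt_of_le_of_lt (by positivity) hN
    exact_mod_cast this
  have := key N hN0
  rw [div_lt_iff₀ hδP] at hN
  linarith

lemma not_type (p : ℝ≥0∞) [Fact (1 ≤ p)] (hp : 2 < p) (hp' : p < ∞) (q : ℝ≥0∞) (hq : 2 < q) :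
    ¬ BMType (Lp ℝ p μI) q := by
  intro h
  obtain ⟨n, hn, C, hC, hN⟩ := h (rs p) (rs_weak p hp hp')
  set s := (1 / q).toReal with hs
  have hs2 : s < 1 / 2 := by
    have h1 : (1 / q) < 1 / 2 := by
      rw [one_div, one_div]; exact ENNReal.inv_lt_inv.2 hq
    have := (ENNReal.toReal_lt_toReal (ne_top_of_lt h1) (by simp)).2 h1
    rw [← hs] at this
    simpa using this
  have key : ∀ N : ℕ, 0 < N → (N : ℝ) ^ (1 / 2 - s) ≤ C * 2 ^ (1 / 2 : ℝ) := by
    intro N hN0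
    have h1 := rs_lower p hp ((Finset.range N).map ⟨n, hn.injective⟩)
    rw [Finset.sum_map, Finset.card_map, Finset.card_range] at h1
    have h2 := h1.trans (hN N)
    have hNp : (0 : ℝ) < N := by exact_mod_cast hN0
    rw [Real.div_rpow hNp.le (by norm_num), div_le_iff₀ (by positivity)] at h2
    rw [Real.rpow_sub hNp, div_le_iff₀ (by positivity)]
    linarith
  have ht : Tendsto (fun N : ℕ => (N : ℝ) ^ (1 / 2 - s)) atTop atTop :=
    (tendsto_rpow_atTop (by linarith)).comp tendsto_natCast_atTop_atTop
  obtain ⟨N, h1, h2⟩ := ((ht.eventually (eventually_gt_atTop (C * 2 ^ (1 / 2 : ℝ)))).and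
    (eventually_gt_atTop 0)).exists
  exact absurd (key N h2) (not_le.2 h1)

end BMAux

/-- For `p ∈ (2,∞)`, the space `L^p(0,1)` (with Lebesgue measure on `(0,1)`) is of
unconditional Banach-Mazur type `2` and not of Banach-Mazur type `q` for any `q ∈ (2,∞]`;
consequently `L^p(0,1)` is not isomorphic to `ℓ^p(ℕ,ℝ)` as a Banach space. -/
theorem bmType_Lp_unit_interval (p : ℝ≥0∞) [Fact (1 ≤ p)] (hp : 2 < p) (hp' : p < ∞) :
    BMUncondType (MeasureTheory.Lp ℝ p
      ((MeasureTheory.volume : MeasureTheory.Measure ℝ).restrict (Set.Ioo 0 1))) 2 ∧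
    (∀ q : ℝ≥0∞, 2 < q → ¬ BMType (MeasureTheory.Lp ℝ p
      ((MeasureTheory.volume : MeasureTheory.Measure ℝ).restrict (Set.Ioo 0 1))) q) ∧
    IsEmpty ((MeasureTheory.Lp ℝ p
        ((MeasureTheory.volume : MeasureTheory.Measure ℝ).restrict (Set.Ioo 0 1)))
      ≃L[ℝ] lp (fun _ : ℕ => ℝ) p) := by
  have h2 : ∀ q : ℝ≥0∞, 2 < q → ¬ BMType (MeasureTheory.Lp ℝ p
      ((MeasureTheory.volume : MeasureTheory.Measure ℝ).restrict (Set.Ioo 0 1))) q :=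
    fun q hq => BMAux.not_type p hp hp' q hq
  have hP : 2 < p.toReal := by
    simpa using (ENNReal.toReal_lt_toReal (by norm_num) hp'.ne).2 hp
  refine ⟨?_, h2, ⟨fun e => h2 p hp (BMAux.BMType_congr e p (BMAux.lp_type p hp'))⟩⟩
  obtain ⟨C, hC, h⟩ := BMAux.Lp_smooth
    (μ := (MeasureTheory.volume : MeasureTheory.Measure ℝ).restrict (Set.Ioo 0 1)) p hp hp'
  exact BMAux.uncond_of_smooth p.toReal C hP hC h
end
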